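/- arXiv:1502.03775 — 2 statements merged into one kernel-verified Lean document; each statement's English description precedes it below -/
import Mathlib

section
/- Let f₁, …, f_J be real-valued harmonic functions on the unit ball B_d of ℝ^d (d ≥ 2), and let w be a weight function on [0,1) (continuous, non-decreasing, unbounded, positive). If there are constants C₁, C₂ > 0 with C₁ w(|x|) ≤ |f₁(x)| + ⋯ + |f_J(x)| ≤ C₂ w(|x|) for all x ∈ B_d, then w is equivalent to a log-convex weight function, i.e., there is a weight function v with log v(r) convex in log r and constants c₁, c₂ > 0 such that c₁ v(r) ≤ w(r) ≤ c₂ v(r) for all r ∈ [0,1). -/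
open MeasureTheory Set Metric

noncomputable section

/-- The open unit ball of `ℝ^d` (as `EuclideanSpace`). -/
def unitBall (d : ℕ) : Set (EuclideanSpace ℝ (Fin d)) := Metric.ball 0 1

/-- `f` is harmonic on `s ⊆ ℝ^d`: it is `C²` on a neighborhood-like set and its
Laplacian (sum of second derivatives in the coordinate directions) vanishes on `s`. -/
def IsHarmonicOn {d : ℕ} (f : EuclideanSpace ℝ (Fin d) → ℝ)
    (s : Set (EuclideanSpace ℝ (Fin d))) : Prop :=
  ContDiffOn ℝ 2 f s ∧ ∀ x ∈ s,
    ∑ i : Fin d, fderiv ℝ (fun y => fderiv ℝ f y (EuclideanSpace.single i 1)) x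
      (EuclideanSpace.single i 1) = 0

/-- A weight function: positive, non-decreasing, continuous and unbounded on `[0,1)`. -/
def IsWeight (w : ℝ → ℝ) : Prop :=
  ContinuousOn w (Set.Ico 0 1) ∧ MonotoneOn w (Set.Ico 0 1) ∧
    (∀ r ∈ Set.Ico (0:ℝ) 1, 0 < w r) ∧
    ∀ M : ℝ, ∃ r ∈ Set.Ico (0:ℝ) 1, M < w r

/-- `w` is log-convex: `log (w r)` is a convex function of `log r` on `(0,1)`. -/
def IsLogConvex (w : ℝ → ℝ) : Prop :=
  ConvexOn ℝ (Set.Iio (0:ℝ)) (fun t => Real.log (w (Real.exp t)))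

/-- Two functions are equivalent on `[0,1)`. -/
def EquivOn01 (w v : ℝ → ℝ) : Prop :=
  ∃ c₁ c₂ : ℝ, 0 < c₁ ∧ 0 < c₂ ∧
    ∀ r ∈ Set.Ico (0:ℝ) 1, c₁ * v r ≤ w r ∧ w r ≤ c₂ * v r

/-- The normalized surface measure on the unit sphere of `ℝ^d`. -/
def sphereMeasure (d : ℕ) : Measure (Metric.sphere (0 : EuclideanSpace ℝ (Fin d)) 1) :=
  ((volume : Measure (EuclideanSpace ℝ (Fin d))).toSphere Set.univ)⁻¹ •
    (volume : Measure (EuclideanSpace ℝ (Fin d))).toSphere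

/-- The squared `L²`-mean of `f` on the sphere of radius `r`. -/
def M2sq {d : ℕ} (f : EuclideanSpace ℝ (Fin d) → ℝ) (r : ℝ) : ℝ :=
  ∫ y : Metric.sphere (0 : EuclideanSpace ℝ (Fin d)) 1,
    (f (r • (y : EuclideanSpace ℝ (Fin d))))^2 ∂(sphereMeasure d)


lemma integral_fderiv_zero {d : ℕ} (F : EuclideanSpace ℝ (Fin d) → ℝ) (hF : ContDiff ℝ 1 F)
    (hs : HasCompactSupport F) (v : EuclideanSpace ℝ (Fin d)) :
    ∫ x, fderiv ℝ F x v = 0 := by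
  have hc : Continuous (fun x => fderiv ℝ F x v) :=
    (hF.continuous_fderiv (by norm_num)).clm_apply continuous_const
  have hi : Integrable (fun x => fderiv ℝ F x v) :=
    hc.integrable_of_hasCompactSupport (hs.fderiv_apply ℝ v)
  have := integral_mul_fderiv_eq_neg_fderiv_mul_of_integrable (μ := volume)
    (f := fun _ : EuclideanSpace ℝ (Fin d) => (1:ℝ)) (g := F) (v := v) (by simp)
    (by simpa using hi) (by simpa using hF.continuous.integrable_of_hasCompactSupport hs)
    (by fun_prop) (fun x _ => (hF.differentiable (by norm_num)) x)
  simpa using this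

lemma sum_coord {d : ℕ} (L : EuclideanSpace ℝ (Fin d) →L[ℝ] ℝ) (x : EuclideanSpace ℝ (Fin d)) :
    ∑ i, x i * L (EuclideanSpace.single i 1) = L x := by
  have := (EuclideanSpace.basisFun (Fin d) ℝ).sum_repr x
  conv_rhs => rw [← this]
  simp

lemma deriv_zero_of {Φ : ℝ → ℝ} (hΦ : ContDiff ℝ 2 Φ) (h0 : ∀ s, 1 ≤ s → Φ s = 0) (s : ℝ)
    (hs : 1 ≤ s) : deriv Φ s = 0 := by
  have h1 := ((hΦ.differentiable (by norm_num)) s).hasDerivAt.hasDerivWithinAt (s := Ici s)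
  have h2 : HasDerivWithinAt Φ 0 (Ici s) s :=
    (hasDerivWithinAt_const s (Ici s) (0:ℝ)).congr (fun y hy => h0 y (hs.trans hy)) (h0 s hs)
  exact (uniqueDiffWithinAt_Ici s).eq_deriv _ h1 h2

lemma green {d : ℕ} (Φ : ℝ → ℝ) (hΦ : ContDiff ℝ 2 Φ) (h0 : ∀ s, 1 ≤ s → Φ s = 0)
    (f : EuclideanSpace ℝ (Fin d) → ℝ) (hf : ContDiff ℝ 2 f) (R : ℝ)
    (hh : ∀ x, ‖x‖ < R → ∑ i : Fin d,
      fderiv ℝ (fun y => fderiv ℝ f y (EuclideanSpace.single i 1)) x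
      (EuclideanSpace.single i 1) = 0) (p q : ℝ) (hp : |p| < R) (hq : |q| < R) :
    ∫ x : EuclideanSpace ℝ (Fin d), deriv Φ (‖x‖^2) * (f (q • x) * fderiv ℝ f (p • x) (p • x)
      - f (p • x) * fderiv ℝ f (q • x) (q • x)) = 0 := by
  let D : Fin d → EuclideanSpace ℝ (Fin d) → ℝ :=
    fun i y => fderiv ℝ f y (EuclideanSpace.single i 1)
  have hD : ∀ i, ContDiff ℝ 1 (D i) := fun i =>
    (hf.fderiv_right (m := 1) (by norm_num)).clm_apply contDiff_const
  let F : Fin d → EuclideanSpace ℝ (Fin d) → ℝ := fun i x =>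
    Φ (‖x‖^2) * (f (q • x) * (p * D i (p • x)) - f (p • x) * (q * D i (q • x)))
  have hf1 : ContDiff ℝ 1 f := hf.of_le (by norm_num)
  have hΦ1 : ContDiff ℝ 1 Φ := hΦ.of_le (by norm_num)
  have hF : ∀ i, ContDiff ℝ 1 (F i) := by
    intro i
    have a1 : ContDiff ℝ 1 (fun x : EuclideanSpace ℝ (Fin d) => Φ (‖x‖^2)) :=
      hΦ1.comp (contDiff_norm_sq ℝ)
    have a2 : ∀ c : ℝ, ContDiff ℝ 1 (fun x : EuclideanSpace ℝ (Fin d) => f (c • x)) :=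
      fun c => hf1.comp (contDiff_const_smul c)
    have a3 : ∀ c : ℝ, ContDiff ℝ 1 (fun x : EuclideanSpace ℝ (Fin d) => D i (c • x)) :=
      fun c => (hD i).comp (contDiff_const_smul c)
    exact a1.mul (((a2 q).mul (contDiff_const.mul (a3 p))).sub
      ((a2 p).mul (contDiff_const.mul (a3 q))))
  have hFs : ∀ i, HasCompactSupport (F i) := by
    intro i
    refine HasCompactSupport.intro (isCompact_closedBall 0 1) (fun x hx => ?_)
    have : 1 < ‖x‖ := by simpa using hx
    simp only [F]
    rw [h0 _ (by nlinarith)]; ring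
  have key : ∀ i, ∀ x, fderiv ℝ (F i) x (EuclideanSpace.single i 1) =
      2 * deriv Φ (‖x‖^2) * x i * (f (q • x) * (p * D i (p • x)) - f (p • x) * (q * D i (q • x)))
      + Φ (‖x‖^2) * (f (q • x) * (p^2 * fderiv ℝ (D i) (p • x) (EuclideanSpace.single i 1))
        - f (p • x) * (q^2 * fderiv ℝ (D i) (q • x) (EuclideanSpace.single i 1))) := by
    intro i x
    have b1 : HasFDerivAt (fun x : EuclideanSpace ℝ (Fin d) => Φ (‖x‖^2))
        (deriv Φ (‖x‖^2) • (2 • innerSL ℝ x)) x :=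
      ((hΦ1.differentiable (by norm_num)) _).hasDerivAt.comp_hasFDerivAt x
        (hasStrictFDerivAt_norm_sq x).hasFDerivAt
    have bs : ∀ c : ℝ, HasFDerivAt (fun x : EuclideanSpace ℝ (Fin d) => c • x)
        (c • ContinuousLinearMap.id ℝ _) x := fun c => (hasFDerivAt_id x).const_smul c
    have b2 : ∀ c : ℝ, HasFDerivAt (fun x : EuclideanSpace ℝ (Fin d) => f (c • x))
        ((fderiv ℝ f (c • x)).comp (c • ContinuousLinearMap.id ℝ _)) x := fun c =>
      ((hf1.differentiable (by norm_num)) _).hasFDerivAt.comp x (bs c)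
    have b3 : ∀ c : ℝ, HasFDerivAt (fun x : EuclideanSpace ℝ (Fin d) => D i (c • x))
        ((fderiv ℝ (D i) (c • x)).comp (c • ContinuousLinearMap.id ℝ _)) x := fun c =>
      (((hD i).differentiable (by norm_num)) _).hasFDerivAt.comp x (bs c)
    have b4 := b1.mul (((b2 q).mul ((b3 p).const_mul p)).sub ((b2 p).mul ((b3 q).const_mul q)))
    have b5 : fderiv ℝ (F i) x = _ := b4.fderiv
    rw [b5]
    simp [EuclideanSpace.inner_single_right]
    change _ = _
    have : ∀ y, fderiv ℝ f y (EuclideanSpace.single i 1) = D i y := fun y => rfl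
    simp only [this]
    ring
  have tot : ∑ i, ∫ x, fderiv ℝ (F i) x (EuclideanSpace.single i 1) = 0 :=
    Finset.sum_eq_zero fun i _ => integral_fderiv_zero (F i) (hF i) (hFs i) _
  rw [← integral_finsetSum] at tot
  swap
  · intro i _
    exact (((hF i).continuous_fderiv (by norm_num)).clm_apply
      continuous_const).integrable_of_hasCompactSupport ((hFs i).fderiv_apply ℝ _)
  have pt : ∀ x : EuclideanSpace ℝ (Fin d),
      ∑ i, fderiv ℝ (F i) x (EuclideanSpace.single i 1) =
      2 * (deriv Φ (‖x‖^2) * (f (q • x) * fderiv ℝ f (p • x) (p • x)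
      - f (p • x) * fderiv ℝ f (q • x) (q • x))) := by
    intro x
    simp only [key, Finset.sum_add_distrib]
    have e2 : ∑ i, Φ (‖x‖^2) * (f (q • x) *
          (p^2 * fderiv ℝ (D i) (p • x) (EuclideanSpace.single i 1))
        - f (p • x) * (q^2 * fderiv ℝ (D i) (q • x) (EuclideanSpace.single i 1))) = 0 := by
      by_cases hx : 1 ≤ ‖x‖
      · refine Finset.sum_eq_zero fun i _ => ?_
        rw [h0 _ (by nlinarith)]; ring
      · push Not at hx
        have hn : ∀ c : ℝ, |c| < R → ‖c • x‖ < R := by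
          intro c hc
          rw [norm_smul, Real.norm_eq_abs]
          nlinarith [abs_nonneg c, norm_nonneg x]
        have h1 := hh _ (hn p hp)
        have h2 := hh _ (hn q hq)
        rw [← Finset.mul_sum, Finset.sum_sub_distrib, ← Finset.mul_sum, ← Finset.mul_sum,
          ← Finset.mul_sum, ← Finset.mul_sum]
        simp only [D]
        rw [h1, h2]; ring
    rw [e2, map_smul, map_smul, ← sum_coord (fderiv ℝ f (p • x)), ← sum_coord (fderiv ℝ f (q • x))]
    simp only [smul_eq_mul, Finset.mul_sum, ← Finset.sum_sub_distrib, add_zero]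
    refine Finset.sum_congr rfl fun i _ => ?_
    simp only [D]; ring
  simp only [pt] at tot
  rw [integral_const_mul] at tot
  linarith

lemma twist {d : ℕ} (Φ : ℝ → ℝ) (hΦ : ContDiff ℝ 2 Φ) (h0 : ∀ s, 1 ≤ s → Φ s = 0)
    (f : EuclideanSpace ℝ (Fin d) → ℝ) (hf : ContDiff ℝ 2 f) (R : ℝ)
    (hh : ∀ x, ‖x‖ < R → ∑ i : Fin d,
      fderiv ℝ (fun y => fderiv ℝ f y (EuclideanSpace.single i 1)) x
      (EuclideanSpace.single i 1) = 0) (a b : ℝ)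
    (h1 : Real.exp (a + b) < R) (h2 : Real.exp (a - b) < R) :
    ∫ x : EuclideanSpace ℝ (Fin d), deriv Φ (‖x‖^2) *
      (f (Real.exp (a + b) • x) * f (Real.exp (a - b) • x)) =
    ∫ x : EuclideanSpace ℝ (Fin d), deriv Φ (‖x‖^2) *
      (f (Real.exp a • x) * f (Real.exp a • x)) := by
  let G : ℝ → EuclideanSpace ℝ (Fin d) → ℝ := fun t x => deriv Φ (‖x‖^2) *
      (f (Real.exp (a + t) • x) * f (Real.exp (a - t) • x))
  let G' : ℝ → EuclideanSpace ℝ (Fin d) → ℝ := fun t x => deriv Φ (‖x‖^2) *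
      (f (Real.exp (a - t) • x) * fderiv ℝ f (Real.exp (a + t) • x) (Real.exp (a + t) • x)
      - f (Real.exp (a + t) • x) * fderiv ℝ f (Real.exp (a - t) • x) (Real.exp (a - t) • x))
  have hcΦ : Continuous (deriv Φ) := hΦ.continuous_deriv (by norm_num)
  have hcf := hf.continuous
  have hcf' : Continuous (fderiv ℝ f) := hf.continuous_fderiv (by norm_num)
  have hG : Continuous (fun z : ℝ × EuclideanSpace ℝ (Fin d) => G z.1 z.2) := by
    simp only [G]; fun_prop
  have hG' : Continuous (fun z : ℝ × EuclideanSpace ℝ (Fin d) => G' z.1 z.2) := by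
    simp only [G']; fun_prop
  have hd0 : ∀ x : EuclideanSpace ℝ (Fin d), x ∉ closedBall 0 1 → deriv Φ (‖x‖^2) = 0 := by
    intro x hx
    have : 1 < ‖x‖ := by simpa using hx
    exact deriv_zero_of hΦ h0 _ (by nlinarith)
  have hder : ∀ t x, HasDerivAt (fun t => G t x) (G' t x) t := by
    intro t x
    have e1 : HasDerivAt (fun t => Real.exp (a + t) • x) (Real.exp (a + t) • x) t := by
      have : HasDerivAt (fun t => Real.exp (a + t)) (Real.exp (a + t)) t := by
        simpa using ((hasDerivAt_id t).const_add a).exp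
      exact this.smul_const x
    have e2 : HasDerivAt (fun t => Real.exp (a - t) • x) (-(Real.exp (a - t) • x)) t := by
      have : HasDerivAt (fun t => Real.exp (a - t)) (-Real.exp (a - t)) t := by
        simpa using ((hasDerivAt_id t).const_sub a).exp
      simpa using this.smul_const x
    have df := hf.differentiable (by norm_num)
    have e3 := ((df _).hasFDerivAt.comp_hasDerivAt t e1).mul
      ((df _).hasFDerivAt.comp_hasDerivAt t e2)
    have e4 := e3.const_mul (deriv Φ (‖x‖^2))
    refine e4.congr_deriv ?_
    simp [G']; left; ring
  have hI : ∀ t, HasDerivAt (fun t => ∫ x, G t x) (∫ x, G' t x) t := by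
    intro t
    obtain ⟨C, hC⟩ := ((isCompact_closedBall t 1).prod
      (isCompact_closedBall (0 : EuclideanSpace ℝ (Fin d)) 1)).exists_bound_of_continuousOn
      hG'.continuousOn
    have hGt : ∀ t, Continuous (G t) := by
      intro t; simp only [G]; fun_prop
    have hGt' : ∀ t, Continuous (G' t) := by
      intro t; simp only [G']; fun_prop
    refine (hasDerivAt_integral_of_dominated_loc_of_deriv_le (s := closedBall t 1)
      (bound := (closedBall (0 : EuclideanSpace ℝ (Fin d)) 1).indicator fun _ => C) (F' := G')
      (closedBall_mem_nhds t one_pos) ?_ ?_ ?_ ?_ ?_ ?_).2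
    · exact Filter.Eventually.of_forall fun t => (hGt t).aestronglyMeasurable
    · refine (hGt t).integrable_of_hasCompactSupport
        (HasCompactSupport.intro (isCompact_closedBall 0 1) (fun x hx => ?_))
      simp [G, hd0 x hx]
    · exact (hGt' t).aestronglyMeasurable
    · refine Filter.Eventually.of_forall fun x s hs => ?_
      by_cases hx : x ∈ closedBall (0 : EuclideanSpace ℝ (Fin d)) 1
      · rw [indicator_of_mem hx]
        exact hC (s, x) ⟨hs, hx⟩
      · rw [indicator_of_notMem hx]
        simp [G', hd0 x hx]
    · rw [integrable_indicator_iff measurableSet_closedBall]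
      exact integrableOn_const (isCompact_closedBall _ _).measure_ne_top
    · exact Filter.Eventually.of_forall fun x s hs => hder s x
  have hz : ∀ t ∈ uIcc 0 b, ∫ x, G' t x = 0 := by
    intro t ht
    have ht' : Real.exp (a + t) < R ∧ Real.exp (a - t) < R := by
      have hm : Real.exp (a + |b|) < R := by
        rcases abs_cases b with h | h <;> rw [h.1]
        · exact h1
        · simpa [sub_eq_add_neg] using h2
      have htb : |t| ≤ |b| := by
        simpa using abs_sub_left_of_mem_uIcc ht
      constructor
      · refine lt_of_le_of_lt (Real.exp_le_exp.2 ?_) hm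
        linarith [le_abs_self t]
      · refine lt_of_le_of_lt (Real.exp_le_exp.2 ?_) hm
        linarith [neg_le_abs t]
    exact green Φ hΦ h0 f hf R hh _ _ (by rw [abs_of_pos (Real.exp_pos _)]; exact ht'.1)
      (by rw [abs_of_pos (Real.exp_pos _)]; exact ht'.2)
  have := (convex_uIcc 0 b).norm_image_sub_le_of_norm_hasDerivWithin_le (C := 0)
    (fun t _ => (hI t).hasDerivWithinAt) (fun t ht => by rw [hz t ht]; simp)
    left_mem_uIcc right_mem_uIcc
  simp only [zero_mul, norm_le_zero_iff, sub_eq_zero] at this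
  simpa [G] using this

lemma approx_convex (g : ℝ → ℝ) (hg : ContinuousOn g (Iio 0)) (δ : ℝ)
    (hm : ∀ x y, x < 0 → y < 0 → g ((x + y) / 2) ≤ (g x + g y) / 2 + δ)
    (x t y : ℝ) (hxt : x < t) (hty : t < y) (hy : y < 0) :
    (y - x) * g t ≤ (y - t) * g x + (t - x) * g y + 2 * δ * (y - x) := by
  have hxy : 0 < y - x := by linarith
  obtain ⟨s, hs⟩ : ∃ s, s * (y - x) = g y - g x := ⟨(g y - g x) / (y - x), by field_simp⟩
  let h : ℝ → ℝ := fun t => g t - (g x + (t - x) * s)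
  have hc : ContinuousOn h (Icc x y) := by
    have : ContinuousOn g (Icc x y) := hg.mono fun z hz => lt_of_le_of_lt hz.2 hy
    exact this.sub (by fun_prop)
  obtain ⟨p, hp, hmax⟩ := isCompact_Icc.exists_isMaxOn ⟨x, left_mem_Icc.2 (by linarith)⟩ hc
  have hM : h p ≤ 2 * δ := by
    rcases le_total p ((x + y) / 2) with hle | hle
    · have h1 := hm x (2 * p - x) (by linarith) (by linarith)
      have h2 := hmax (show 2 * p - x ∈ Icc x y from ⟨by linarith [hp.1], by linarith⟩)
      rw [show (x + (2 * p - x)) / 2 = p by ring] at h1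
      simp only [h, mem_ofPred_eq] at h2 ⊢
      linarith
    · have h1 := hm y (2 * p - y) (by linarith) (by linarith [hp.2])
      have h2 := hmax (show 2 * p - y ∈ Icc x y from ⟨by linarith, by linarith [hp.2]⟩)
      rw [show (y + (2 * p - y)) / 2 = p by ring] at h1
      simp only [h, mem_ofPred_eq] at h2 ⊢
      linarith
  have h3 : h t ≤ 2 * δ := le_trans (hmax (show t ∈ Icc x y from ⟨hxt.le, hty.le⟩)) hM
  simp only [h] at h3
  have h4 := mul_le_mul_of_nonneg_left h3 hxy.le
  have h5 : (t - x) * (s * (y - x)) = (t - x) * (g y - g x) := by rw [hs]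
  nlinarith

/-- supporting lines of nonnegative slope -/
lemma support_line (g : ℝ → ℝ) (hmono : MonotoneOn g (Iio 0)) (D : ℝ) (hD : 0 ≤ D)
    (hc : ∀ x t y, x < t → t < y → y < 0 →
      (y - x) * g t ≤ (y - t) * g x + (t - x) * g y + D * (y - x))
    (t : ℝ) (ht : t < 0) :
    ∃ m, 0 ≤ m ∧ ∀ s < 0, m * (s - t) + (g t - D) ≤ g s := by
  let S : Set ℝ := insert 0 (Set.image (fun x => (g t - D - g x) / (t - x)) (Iio t))
  have hub : ∀ y, t < y → y < 0 → ∀ z ∈ S, z ≤ (g y - (g t - D)) / (y - t) := by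
    intro y hty hy z hz
    have hyt : 0 < y - t := by linarith
    rcases hz with rfl | ⟨x, hx, rfl⟩
    · apply div_nonneg _ hyt.le
      have := hmono (show t ∈ Iio 0 from ht) (show y ∈ Iio 0 from hy) hty.le
      linarith
    · have hx' : x < t := hx
      have : 0 < t - x := by linarith
      show (g t - D - g x) / (t - x) ≤ _
      rw [div_le_div_iff₀ this hyt]
      nlinarith [hc x t y hx' hty hy]
  have hbdd : BddAbove S := ⟨_, hub (t/2) (by linarith) (by linarith)⟩
  refine ⟨sSup S, le_csSup hbdd (mem_insert _ _), fun s hs => ?_⟩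
  rcases lt_trichotomy s t with h | h | h
  · have h1 : (g t - D - g s) / (t - s) ≤ sSup S :=
      le_csSup hbdd (mem_insert_of_mem _ ⟨s, h, rfl⟩)
    rw [div_le_iff₀ (by linarith)] at h1
    nlinarith
  · subst h; linarith
  · have h1 : sSup S ≤ (g s - (g t - D)) / (s - t) :=
      csSup_le ⟨0, mem_insert _ _⟩ (hub s h hs)
    rw [le_div_iff₀ (by linarith)] at h1
    linarith

lemma envelope (g : ℝ → ℝ) (hmono : MonotoneOn g (Iio 0)) (D : ℝ) (hD : 0 ≤ D)
    (hc : ∀ x t y, x < t → t < y → y < 0 →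
      (y - x) * g t ≤ (y - t) * g x + (t - x) * g y + D * (y - x))
    (L : ℝ) (hL : ∀ t < 0, L ≤ g t) :
    ∃ G : ℝ → ℝ, ConvexOn ℝ (Iio 0) G ∧ MonotoneOn G (Iio 0) ∧
      ∀ t < 0, L ≤ G t ∧ G t ≤ g t ∧ g t - D ≤ G t := by
  let P : Set (ℝ × ℝ) := {z | 0 ≤ z.1 ∧ ∀ s < 0, z.1 * s + z.2 ≤ g s}
  let S : ℝ → Set ℝ := fun t => Set.image (fun z : ℝ × ℝ => z.1 * t + z.2) P
  have hP0 : ((0, L) : ℝ × ℝ) ∈ P := ⟨le_rfl, fun s hs => by simpa using hL s hs⟩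
  have hne : ∀ t, (S t).Nonempty := fun t => ⟨_, _, hP0, rfl⟩
  have hub : ∀ t < 0, ∀ z ∈ S t, z ≤ g t := by
    rintro t ht _ ⟨z, hz, rfl⟩; exact hz.2 t ht
  have hb : ∀ t < 0, BddAbove (S t) := fun t ht => ⟨_, hub t ht⟩
  have hle : ∀ t < 0, ∀ z ∈ P, z.1 * t + z.2 ≤ sSup (S t) :=
    fun t ht z hz => le_csSup (hb t ht) ⟨z, hz, rfl⟩
  refine ⟨fun t => sSup (S t), ⟨convex_Iio 0, ?_⟩, ?_, ?_⟩
  · intro x hx y hy a b ha hb' hab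
    apply csSup_le (hne _)
    rintro _ ⟨z, hz, rfl⟩
    have h1 := mul_le_mul_of_nonneg_left (hle x hx z hz) ha
    have h2 := mul_le_mul_of_nonneg_left (hle y hy z hz) hb'
    have : z.2 = a * z.2 + b * z.2 := by rw [← add_mul, hab, one_mul]
    simp only [smul_eq_mul]
    nlinarith
  · intro x hx y hy hxy
    apply csSup_le (hne _)
    rintro _ ⟨z, hz, rfl⟩
    refine le_trans ?_ (hle y hy z hz)
    have := mul_le_mul_of_nonneg_left hxy hz.1
    simp only; linarith
  · intro t ht
    refine ⟨by simpa using hle t ht _ hP0, csSup_le (hne t) (hub t ht), ?_⟩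
    obtain ⟨m, hm, h⟩ := support_line g hmono D hD hc t ht
    have := hle t ht (m, g t - D - m * t) ⟨hm, fun s hs => by
      have := h s hs; simp only; linarith⟩
    simp only at this ⊢
    linarith

lemma extend_harmonic {d : ℕ} (f : EuclideanSpace ℝ (Fin d) → ℝ) (hf : IsHarmonicOn f (unitBall d))
    (R : ℝ) (hR0 : 0 < R) (hR : R < 1) :
    ∃ F : EuclideanSpace ℝ (Fin d) → ℝ, ContDiff ℝ 2 F ∧ (∀ x, ‖x‖ < R → F x = f x) ∧
      ∀ x, ‖x‖ < R → ∑ i : Fin d,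
      fderiv ℝ (fun y => fderiv ℝ F y (EuclideanSpace.single i 1)) x
      (EuclideanSpace.single i 1) = 0 := by
  let χ : ContDiffBump (0 : EuclideanSpace ℝ (Fin d)) :=
    ⟨R, (1 + R) / 2, hR0, by linarith⟩
  have heq : ∀ x : EuclideanSpace ℝ (Fin d), ‖x‖ < R → (fun x => χ x * f x) =ᶠ[nhds x] f := by
    intro x hx
    have : χ =ᶠ[nhds x] 1 := χ.eventuallyEq_one_of_mem_ball (by simpa [χ] using hx)
    filter_upwards [this] with y hy
    simp [hy]
  refine ⟨fun x => χ x * f x, ?_, fun x hx => (heq x hx).eq_of_nhds, fun x hx => ?_⟩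
  · rw [contDiff_iff_contDiffAt]
    intro x
    by_cases hx : ‖x‖ < 1
    · have : ContDiffAt ℝ 2 f x :=
        hf.1.contDiffAt (isOpen_ball.mem_nhds (by simpa [unitBall] using hx))
      exact χ.contDiffAt.mul this
    · have hx' : x ∉ tsupport χ := by
        rw [χ.tsupport_eq]
        simp only [χ, mem_closedBall, dist_zero_right, not_le]
        push Not at hx; linarith
      have h0 : (fun x => χ x * f x) =ᶠ[nhds x] fun _ => 0 := by
        have := notMem_tsupport_iff_eventuallyEq.1 hx'
        filter_upwards [this] with y hy
        simp [hy]
      exact contDiffAt_const.congr_of_eventuallyEq h0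
  · rw [← hf.2 x (by simp [unitBall]; linarith)]
    refine Finset.sum_congr rfl fun i _ => ?_
    have h1 : (fun y => fderiv ℝ (fun x => χ x * f x) y (EuclideanSpace.single i 1)) =ᶠ[nhds x]
        fun y => fderiv ℝ f y (EuclideanSpace.single i 1) := by
      filter_upwards [(heq x hx).fderiv (𝕜 := ℝ)] with y hy
      rw [hy]
    rw [h1.fderiv_eq]

lemma twist' {d : ℕ} (Φ : ℝ → ℝ) (hΦ : ContDiff ℝ 2 Φ) (h0 : ∀ s, 1 ≤ s → Φ s = 0)
    (f : EuclideanSpace ℝ (Fin d) → ℝ) (hf : IsHarmonicOn f (unitBall d)) (a b : ℝ)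
    (h1 : a + b < 0) (h2 : a - b < 0) :
    Integrable (fun x : EuclideanSpace ℝ (Fin d) => deriv Φ (‖x‖^2) *
      (f (Real.exp (a + b) • x) * f (Real.exp (a - b) • x))) ∧
    Integrable (fun x : EuclideanSpace ℝ (Fin d) => deriv Φ (‖x‖^2) *
      (f (Real.exp a • x) * f (Real.exp a • x))) ∧
    ∫ x : EuclideanSpace ℝ (Fin d), deriv Φ (‖x‖^2) *
      (f (Real.exp (a + b) • x) * f (Real.exp (a - b) • x)) =
    ∫ x : EuclideanSpace ℝ (Fin d), deriv Φ (‖x‖^2) *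
      (f (Real.exp a • x) * f (Real.exp a • x)) := by
  obtain ⟨R, hR1, hR⟩ := exists_between
    (max_lt (Real.exp_lt_one_iff.2 h1) (Real.exp_lt_one_iff.2 h2))
  have hp := lt_of_le_of_lt (le_max_left _ _) hR1
  have hq := lt_of_le_of_lt (le_max_right _ _) hR1
  have hR0 : 0 < R := lt_trans (Real.exp_pos _) hp
  have ha : Real.exp a < R := by
    rcases le_total 0 b with hb | hb
    · exact lt_of_le_of_lt (Real.exp_le_exp.2 (by linarith)) hp
    · exact lt_of_le_of_lt (Real.exp_le_exp.2 (by linarith)) hq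
  obtain ⟨F, hF, hFe, hFh⟩ := extend_harmonic f hf R hR0 hR
  have hd0 : ∀ x : EuclideanSpace ℝ (Fin d), 1 ≤ ‖x‖ → deriv Φ (‖x‖^2) = 0 := by
    intro x hx
    exact deriv_zero_of hΦ h0 _ (by nlinarith)
  have hn : ∀ (x : EuclideanSpace ℝ (Fin d)) (c : ℝ), ‖x‖ < 1 → 0 < c → c < R →
      F (c • x) = f (c • x) := by
    intro x c hx hc0 hc
    apply hFe
    rw [norm_smul, Real.norm_eq_abs, abs_of_pos hc0]
    nlinarith [norm_nonneg x]
  have hfun : ∀ p q : ℝ, 0 < p → p < R → 0 < q → q < R →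
      (fun x : EuclideanSpace ℝ (Fin d) => deriv Φ (‖x‖^2) * (f (p • x) * f (q • x))) =
      fun x => deriv Φ (‖x‖^2) * (F (p • x) * F (q • x)) := by
    intro p q hp0 hp hq0 hq
    funext x
    by_cases hx : ‖x‖ < 1
    · rw [hn x p hx hp0 hp, hn x q hx hq0 hq]
    · rw [hd0 x (not_lt.1 hx)]; ring
  have hcΦ : Continuous (deriv Φ) := hΦ.continuous_deriv (by norm_num)
  have hcF := hF.continuous
  have hint : ∀ p q : ℝ, Integrable
      fun x : EuclideanSpace ℝ (Fin d) => deriv Φ (‖x‖^2) * (F (p • x) * F (q • x)) := by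
    intro p q
    refine Continuous.integrable_of_hasCompactSupport (by fun_prop)
        (HasCompactSupport.intro (isCompact_closedBall 0 1) (fun x hx => ?_))
    rw [hd0 x (by have : 1 < ‖x‖ := by simpa using hx
                  exact this.le)]
    ring
  rw [hfun _ _ (Real.exp_pos _) hp (Real.exp_pos _) hq,
    hfun _ _ (Real.exp_pos _) ha (Real.exp_pos _) ha]
  exact ⟨hint _ _, hint _ _, twist Φ hΦ h0 F hF R hFh a b hp hq⟩

lemma exists_profile (ρ : ℝ) (h0 : 0 < ρ) (h1 : ρ < 1) :
    ∃ Φ : ℝ → ℝ, ContDiff ℝ 2 Φ ∧ (∀ s, 1 ≤ s → Φ s = 0) ∧ (∀ s, deriv Φ s ≤ 0) ∧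
      (∀ s, s < ρ^2 → deriv Φ s = 0) ∧ ∃ s, 0 < s ∧ deriv Φ s ≠ 0 := by
  have hρ : 0 < 1 - ρ^2 := by nlinarith
  let Φ : ℝ → ℝ := fun s => Real.smoothTransition ((1 - s) / (1 - ρ^2))
  have hΦ : ContDiff ℝ 2 Φ :=
    (Real.smoothTransition.contDiff (n := 2)).comp (by fun_prop)
  have hz : ∀ s, 1 ≤ s → Φ s = 0 := fun s hs =>
    Real.smoothTransition.zero_of_nonpos (div_nonpos_of_nonpos_of_nonneg (by linarith) hρ.le)
  have ho : ∀ s, s ≤ ρ^2 → Φ s = 1 := fun s hs =>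
    Real.smoothTransition.one_of_one_le (by rw [le_div_iff₀ hρ]; linarith)
  have hanti : Antitone Φ := fun s t hst =>
    Real.smoothTransition.monotone (by gcongr)
  refine ⟨Φ, hΦ, hz, fun s => hanti.deriv_nonpos, ?_, ?_⟩
  · intro s hs
    have : Φ =ᶠ[nhds s] fun _ => 1 := by
      filter_upwards [Iio_mem_nhds hs] with t ht
      exact ho t (le_of_lt ht)
    rw [this.deriv_eq]; simp
  · obtain ⟨c, hc, hc'⟩ := exists_deriv_eq_slope Φ (show ρ^2 < 1 by linarith)
      hΦ.continuous.continuousOn (hΦ.differentiable (by norm_num)).differentiableOn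
    refine ⟨c, lt_trans (by positivity) hc.1, ?_⟩
    rw [hc', hz 1 le_rfl, ho _ le_rfl]
    exact div_ne_zero (by norm_num) hρ.ne'

lemma mid_ineq_aux {d : ℕ} (hd : 2 ≤ d) (w : ℝ → ℝ) (hw : IsWeight w)
    (J : ℕ) (f : Fin J → (EuclideanSpace ℝ (Fin d) → ℝ))
    (hf : ∀ j, IsHarmonicOn (f j) (unitBall d))
    (C₁ C₂ : ℝ) (hC₁ : 0 < C₁) (hC₂ : 0 < C₂)
    (h : ∀ x ∈ unitBall d,
      C₁ * w ‖x‖ ≤ ∑ j, |f j x| ∧ ∑ j, |f j x| ≤ C₂ * w ‖x‖) (a b : ℝ)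
    (h1 : a + b < 0) (h2 : a - b < 0) (ρ : ℝ) (hρ0 : 0 < ρ) (hρ1 : ρ < 1) :
    C₁^2 * w (Real.exp a * ρ)^2 ≤ J * (C₂^2 * (w (Real.exp (a + b)) * w (Real.exp (a - b)))) := by
  obtain ⟨hwc, hwm, hwp, -⟩ := hw
  obtain ⟨Φ, hΦ, hz, hneg, hin, s₀, hs₀, hne⟩ := exists_profile ρ hρ0 hρ1
  have ha : a < 0 := by linarith
  let ψ : EuclideanSpace ℝ (Fin d) → ℝ := fun x => - deriv Φ (‖x‖^2)
  have hψ0 : ∀ x, 0 ≤ ψ x := fun x => by simpa [ψ] using hneg _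
  have hψout : ∀ x, 1 ≤ ‖x‖ → ψ x = 0 := fun x hx => by
    simp [ψ, deriv_zero_of hΦ hz (‖x‖^2) (by nlinarith)]
  have hψin : ∀ x, ‖x‖ < ρ → ψ x = 0 := fun x hx => by
    simp [ψ, hin (‖x‖^2) (by nlinarith [norm_nonneg x])]
  have hcΦ : Continuous (deriv Φ) := hΦ.continuous_deriv (by norm_num)
  have hψc : Continuous ψ := by simp only [ψ]; fun_prop
  have hψs : HasCompactSupport ψ :=
    HasCompactSupport.intro (isCompact_closedBall 0 1) (fun x hx => hψout x (by
      have : 1 < ‖x‖ := by simpa using hx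
      exact this.le))
  have hψi : Integrable ψ := hψc.integrable_of_hasCompactSupport hψs
  let x₀ : EuclideanSpace ℝ (Fin d) := EuclideanSpace.single ⟨0, by omega⟩ (Real.sqrt s₀)
  have hψne : ψ x₀ ≠ 0 := by
    simp [ψ, x₀, Real.sq_sqrt hs₀.le, hne]
  have hZ : 0 < ∫ x, ψ x :=
    hψc.integral_pos_of_hasCompactSupport_nonneg_nonzero hψs hψ0 hψne
  set r := Real.exp (a + b) with hr
  set s := Real.exp (a - b) with hs
  set m := Real.exp a with hm
  have hr0 : 0 < r := Real.exp_pos _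
  have hs0 : 0 < s := Real.exp_pos _
  have hm0 : 0 < m := Real.exp_pos _
  have hr1 : r < 1 := Real.exp_lt_one_iff.2 h1
  have hs1 : s < 1 := Real.exp_lt_one_iff.2 h2
  have hm1 : m < 1 := Real.exp_lt_one_iff.2 ha
  have htw := fun j => twist' Φ hΦ hz (f j) (hf j) a b h1 h2
  have hi1 : ∀ j, Integrable fun x => ψ x * (f j (r • x) * f j (s • x)) := fun j => by
    simpa [ψ] using (htw j).1
  have hi2 : ∀ j, Integrable fun x => ψ x * (f j (m • x) * f j (m • x)) := fun j => by
    simpa [ψ] using (htw j).2.1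
  have hee : ∀ j, ∫ x, ψ x * (f j (r • x) * f j (s • x)) =
      ∫ x, ψ x * (f j (m • x) * f j (m • x)) := fun j => by
    have := (htw j).2.2
    simp only [ψ, neg_mul, integral_neg]
    rw [this]
  have hsum : ∫ x, ∑ j, ψ x * (f j (r • x) * f j (s • x)) =
      ∫ x, ∑ j, ψ x * (f j (m • x) * f j (m • x)) := by
    rw [integral_finsetSum _ fun j _ => hi1 j, integral_finsetSum _ fun j _ => hi2 j]
    exact Finset.sum_congr rfl fun j _ => hee j
  have hnorm : ∀ (c : ℝ) (x : EuclideanSpace ℝ (Fin d)), 0 < c → ‖c • x‖ = c * ‖x‖ := by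
    intro c x hc
    rw [norm_smul, Real.norm_eq_abs, abs_of_pos hc]
  have hball : ∀ (c : ℝ) (x : EuclideanSpace ℝ (Fin d)), 0 < c → c < 1 → ‖x‖ < 1 →
      c * ‖x‖ < 1 := by
    intro c x hc hc1 hx; nlinarith [norm_nonneg x]
  have hupper : ∀ (c : ℝ) (x : EuclideanSpace ℝ (Fin d)), 0 < c → c < 1 → ‖x‖ < 1 →
      ∑ j, |f j (c • x)| ≤ C₂ * w c := by
    intro c x hc hc1 hx
    have hb := hball c x hc hc1 hx
    refine le_trans (h (c • x) (by simpa [unitBall, hnorm c x hc] using hb)).2 ?_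
    rw [hnorm c x hc]
    refine mul_le_mul_of_nonneg_left (hwm ⟨by positivity, hb⟩ ⟨hc.le, hc1⟩ ?_) hC₂.le
    nlinarith [norm_nonneg x]
  have hlow : ∀ x : EuclideanSpace ℝ (Fin d), ρ ≤ ‖x‖ → ‖x‖ < 1 →
      C₁ * w (m * ρ) ≤ ∑ j, |f j (m • x)| := by
    intro x hx0 hx
    have hb := hball m x hm0 hm1 hx
    refine le_trans ?_ (h (m • x) (by simpa [unitBall, hnorm m x hm0] using hb)).1
    rw [hnorm m x hm0]
    exact mul_le_mul_of_nonneg_left (hwm ⟨by positivity, by nlinarith⟩ ⟨by positivity, hb⟩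
      (by gcongr)) hC₁.le
  have hwmρ : 0 < w (m * ρ) := hwp _ ⟨by positivity, by nlinarith⟩
  have hwr : 0 < w r := hwp _ ⟨hr0.le, hr1⟩
  have hws : 0 < w s := hwp _ ⟨hs0.le, hs1⟩
  have hup : ∀ x, ∑ j, ψ x * (f j (r • x) * f j (s • x)) ≤ ψ x * (C₂^2 * (w r * w s)) := by
    intro x
    rw [← Finset.mul_sum]
    by_cases hx : ‖x‖ < 1
    · refine mul_le_mul_of_nonneg_left ?_ (hψ0 x)
      calc ∑ j, f j (r • x) * f j (s • x) ≤ ∑ j, |f j (r • x)| * |f j (s • x)| :=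
            Finset.sum_le_sum fun j _ => by rw [← abs_mul]; exact le_abs_self _
        _ ≤ (∑ j, |f j (r • x)|) * ∑ j, |f j (s • x)| := by
            rw [Finset.sum_mul]
            refine Finset.sum_le_sum fun j _ => mul_le_mul_of_nonneg_left ?_ (abs_nonneg _)
            exact Finset.single_le_sum (f := fun j => |f j (s • x)|)
              (fun i _ => abs_nonneg _) (Finset.mem_univ j)
        _ ≤ (C₂ * w r) * (C₂ * w s) :=
            mul_le_mul (hupper r x hr0 hr1 hx) (hupper s x hs0 hs1 hx)
              (Finset.sum_nonneg fun _ _ => abs_nonneg _) (by positivity)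
        _ = C₂^2 * (w r * w s) := by ring
    · simp [hψout x (not_lt.1 hx)]
  have hlo : ∀ x, ψ x * (C₁^2 * w (m * ρ)^2) ≤ J * ∑ j, ψ x * (f j (m • x) * f j (m • x)) := by
    intro x
    rw [← Finset.mul_sum, mul_left_comm (J:ℝ)]
    by_cases hx : ‖x‖ < 1
    · by_cases hx' : ‖x‖ < ρ
      · simp [hψin x hx']
      · refine mul_le_mul_of_nonneg_left ?_ (hψ0 x)
        have e1 := hlow x (not_lt.1 hx') hx
        have e2 : (∑ j, |f j (m • x)|)^2 ≤ (J:ℝ) * ∑ j, |f j (m • x)|^2 := by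
          simpa using sq_sum_le_card_mul_sum_sq (s := Finset.univ) (f := fun j => |f j (m • x)|)
        have e3 : (C₁ * w (m * ρ))^2 ≤ (∑ j, |f j (m • x)|)^2 :=
          pow_le_pow_left₀ (by positivity) e1 2
        calc C₁^2 * w (m * ρ)^2 = (C₁ * w (m * ρ))^2 := by ring
          _ ≤ _ := e3.trans e2
          _ = _ := by simp only [pow_two, abs_mul_abs_self]
    · simp [hψout x (not_lt.1 hx)]
  have I1 : (∫ x, ψ x) * (C₁^2 * w (m * ρ)^2) ≤
      J * ∫ x, ∑ j, ψ x * (f j (m • x) * f j (m • x)) := by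
    rw [← integral_mul_const, ← integral_const_mul]
    exact integral_mono (hψi.mul_const _)
      ((integrable_finsetSum _ fun j _ => hi2 j).const_mul _) hlo
  have I2 : ∫ x, ∑ j, ψ x * (f j (r • x) * f j (s • x)) ≤
      (∫ x, ψ x) * (C₂^2 * (w r * w s)) := by
    rw [← integral_mul_const]
    exact integral_mono (integrable_finsetSum _ fun j _ => hi1 j) (hψi.mul_const _) hup
  rw [← hsum] at I1
  have I3 := I1.trans (mul_le_mul_of_nonneg_left I2 (Nat.cast_nonneg J))
  rw [mul_left_comm (J:ℝ)] at I3
  exact le_of_mul_le_mul_left I3 hZ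

lemma mid_ineq {d : ℕ} (hd : 2 ≤ d) (w : ℝ → ℝ) (hw : IsWeight w)
    (J : ℕ) (f : Fin J → (EuclideanSpace ℝ (Fin d) → ℝ))
    (hf : ∀ j, IsHarmonicOn (f j) (unitBall d))
    (C₁ C₂ : ℝ) (hC₁ : 0 < C₁) (hC₂ : 0 < C₂)
    (h : ∀ x ∈ unitBall d,
      C₁ * w ‖x‖ ≤ ∑ j, |f j x| ∧ ∑ j, |f j x| ≤ C₂ * w ‖x‖) (a b : ℝ)
    (h1 : a + b < 0) (h2 : a - b < 0) :
    C₁^2 * w (Real.exp a)^2 ≤ J * (C₂^2 * (w (Real.exp (a + b)) * w (Real.exp (a - b)))) := by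
  have hca : ContinuousAt w (Real.exp a * 1) := by
    rw [mul_one]
    exact hw.1.continuousAt (Ico_mem_nhds (Real.exp_pos _) (Real.exp_lt_one_iff.2 (by linarith)))
  have ht : Filter.Tendsto (fun ρ => C₁^2 * w (Real.exp a * ρ)^2) (nhdsWithin 1 (Iio 1))
      (nhds (C₁^2 * w (Real.exp a * 1)^2)) := by
    have : ContinuousAt (fun ρ : ℝ => C₁^2 * w (Real.exp a * ρ)^2) 1 := by
      have h3 : ContinuousAt (fun ρ : ℝ => w (Real.exp a * ρ)) 1 :=
        ContinuousAt.comp (f := fun ρ : ℝ => Real.exp a * ρ) hca (by fun_prop)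
      exact continuousAt_const.mul (h3.pow 2)
    exact this.tendsto.mono_left nhdsWithin_le_nhds
  rw [mul_one] at ht
  refine le_of_tendsto ht ?_
  filter_upwards [Ioo_mem_nhdsLT (show (0:ℝ) < 1 by norm_num)] with ρ hρ
  exact mid_ineq_aux hd w hw J f hf C₁ C₂ hC₁ hC₂ h a b h1 h2 ρ hρ.1 hρ.2

lemma real_part (w : ℝ → ℝ) (hw : IsWeight w) (K : ℝ) (hK : 1 ≤ K)
    (hm : ∀ a b, a + b < 0 → a - b < 0 →
      w (Real.exp a)^2 ≤ K * (w (Real.exp (a + b)) * w (Real.exp (a - b)))) :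
    ∃ v : ℝ → ℝ, IsWeight v ∧ IsLogConvex v ∧ EquivOn01 w v := by
  obtain ⟨hwc, hwm, hwp, hwu⟩ := hw
  have hmem : ∀ t < 0, Real.exp t ∈ Ico (0:ℝ) 1 :=
    fun t ht => ⟨(Real.exp_pos _).le, Real.exp_lt_one_iff.2 ht⟩
  have hpos : ∀ t < 0, 0 < w (Real.exp t) := fun t ht => hwp _ (hmem t ht)
  have hw0 : 0 < w 0 := hwp 0 (by simp)
  let g : ℝ → ℝ := fun t => Real.log (w (Real.exp t))
  have hgc : ContinuousOn g (Iio 0) := by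
    refine ContinuousOn.log ?_ (fun t ht => (hpos t ht).ne')
    exact hwc.comp Real.continuous_exp.continuousOn (fun t ht => hmem t ht)
  have hgm : MonotoneOn g (Iio 0) := fun x hx y hy hxy =>
    Real.log_le_log (hpos x hx) (hwm (hmem x hx) (hmem y hy) (Real.exp_le_exp.2 hxy))
  have hmid : ∀ x y, x < 0 → y < 0 → g ((x + y) / 2) ≤ (g x + g y) / 2 + Real.log K / 2 := by
    intro x y hx hy
    have h1 := hm ((x + y) / 2) ((x - y) / 2) (by linarith) (by linarith)
    rw [show (x + y) / 2 + (x - y) / 2 = x by ring, show (x + y) / 2 - (x - y) / 2 = y by ring] at h1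
    have h2 := Real.log_le_log (pow_pos (hpos _ (by linarith)) 2) h1
    rw [Real.log_pow, Real.log_mul (by positivity) (mul_pos (hpos x hx) (hpos y hy)).ne',
      Real.log_mul (hpos x hx).ne' (hpos y hy).ne'] at h2
    push_cast at h2
    simp only [g]
    linarith
  have hlK : 0 ≤ Real.log K := Real.log_nonneg hK
  obtain ⟨G, hGc, hGm, hG⟩ := envelope g hgm (Real.log K) hlK (by
    intro x t y h1 h2 h3
    have := approx_convex g hgc (Real.log K / 2) hmid x t y h1 h2 h3
    linarith) (Real.log (w 0)) (fun t ht => Real.log_le_log hw0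
      (hwm (by simp) (hmem t ht) (Real.exp_pos _).le))
  let v : ℝ → ℝ := fun r => if r = 0 then w 0 else Real.exp (G (Real.log r))
  have hv0 : v 0 = w 0 := by simp [v]
  have hvr : ∀ r, 0 < r → v r = Real.exp (G (Real.log r)) := fun r hr => by simp [v, hr.ne']
  have hlog : ∀ r, 0 < r → r < 1 → Real.log r < 0 := fun r h0 h1 => Real.log_neg h0 h1
  have hlow : ∀ r ∈ Ico (0:ℝ) 1, w 0 ≤ v r := by
    rintro r ⟨h0, h1⟩
    rcases h0.eq_or_lt with rfl | h0
    · rw [hv0]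
    · rw [hvr r h0, ← Real.log_le_iff_le_exp hw0]
      exact (hG _ (hlog r h0 h1)).1
  have hle : ∀ r ∈ Ico (0:ℝ) 1, v r ≤ w r := by
    rintro r ⟨h0, h1⟩
    rcases h0.eq_or_lt with rfl | h0
    · rw [hv0]
    · rw [hvr r h0, ← Real.le_log_iff_exp_le (hwp r ⟨h0.le, h1⟩)]
      have := (hG _ (hlog r h0 h1)).2.1
      simpa [g, Real.exp_log h0] using this
  have hge : ∀ r ∈ Ico (0:ℝ) 1, w r ≤ K * v r := by
    rintro r ⟨h0, h1⟩
    rcases h0.eq_or_lt with rfl | h0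
    · rw [hv0]; nlinarith
    · have h2 := (hG _ (hlog r h0 h1)).2.2
      simp only [g, Real.exp_log h0] at h2
      rw [hvr r h0]
      calc w r = Real.exp (Real.log (w r)) := (Real.exp_log (hwp r ⟨h0.le, h1⟩)).symm
        _ ≤ Real.exp (Real.log K + G (Real.log r)) := Real.exp_le_exp.2 (by linarith)
        _ = _ := by rw [Real.exp_add, Real.exp_log (by linarith)]
  refine ⟨v, ⟨?_, ?_, ?_, ?_⟩, ?_, ⟨1, K, one_pos, by linarith, fun r hr =>
    ⟨by rw [one_mul]; exact hle r hr, hge r hr⟩⟩⟩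
  · rintro r ⟨h0, h1⟩
    rcases h0.eq_or_lt with rfl | h0
    · have hw' : Filter.Tendsto w (nhdsWithin 0 (Ico 0 1)) (nhds (w 0)) := hwc 0 (by simp)
      show Filter.Tendsto v _ _
      rw [hv0]
      refine tendsto_of_tendsto_of_tendsto_of_le_of_le' tendsto_const_nhds hw' ?_ ?_
      · filter_upwards [self_mem_nhdsWithin] with r hr using hlow r hr
      · filter_upwards [self_mem_nhdsWithin] with r hr using hle r hr
    · have hGa : ContinuousAt G (Real.log r) :=
        (hGc.continuousOn isOpen_Iio).continuousAt (Iio_mem_nhds (hlog r h0 h1))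
      have h3 : ContinuousAt (fun r => Real.exp (G (Real.log r))) r :=
        Real.continuous_exp.continuousAt.comp
          (ContinuousAt.comp (f := Real.log) hGa (Real.continuousAt_log h0.ne'))
      have h4 : v =ᶠ[nhds r] fun r => Real.exp (G (Real.log r)) := by
        filter_upwards [Ioi_mem_nhds h0] with s hs using hvr s hs
      exact (h3.congr h4.symm).continuousWithinAt
  · rintro x hx y hy hxy
    rcases hx.1.eq_or_lt with rfl | h0
    · rw [hv0]; exact hlow y hy
    · have hy0 : 0 < y := h0.trans_le hxy
      rw [hvr x h0, hvr y hy0]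
      exact Real.exp_le_exp.2 (hGm (hlog x h0 hx.2) (hlog y hy0 hy.2) (Real.log_le_log h0 hxy))
  · exact fun r hr => hw0.trans_le (hlow r hr)
  · intro M
    obtain ⟨r, hr, hM⟩ := hwu (K * M)
    refine ⟨r, hr, ?_⟩
    have := hge r hr
    exact lt_of_mul_lt_mul_left (hM.trans_le this) (by linarith)
  · refine hGc.congr fun t _ => ?_
    simp [hvr _ (Real.exp_pos t)]

theorem stmt2 {d : ℕ} (hd : 2 ≤ d) (w : ℝ → ℝ) (hw : IsWeight w)
    (J : ℕ) (f : Fin J → (EuclideanSpace ℝ (Fin d) → ℝ))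
    (hf : ∀ j, IsHarmonicOn (f j) (unitBall d))
    (C₁ C₂ : ℝ) (hC₁ : 0 < C₁) (hC₂ : 0 < C₂)
    (h : ∀ x ∈ unitBall d,
      C₁ * w ‖x‖ ≤ ∑ j, |f j x| ∧ ∑ j, |f j x| ≤ C₂ * w ‖x‖) :
    ∃ v : ℝ → ℝ, IsWeight v ∧ IsLogConvex v ∧ EquivOn01 w v := by
  refine real_part w hw (max 1 (J * C₂^2 / C₁^2)) (le_max_left _ _) fun a b h1 h2 => ?_
  have h3 := mid_ineq hd w hw J f hf C₁ C₂ hC₁ hC₂ h a b h1 h2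
  have hp : ∀ t < 0, 0 < w (Real.exp t) :=
    fun t ht => hw.2.2.1 _ ⟨(Real.exp_pos _).le, Real.exp_lt_one_iff.2 ht⟩
  have hpp := mul_pos (hp _ h1) (hp _ h2)
  refine le_trans ?_ (mul_le_mul_of_nonneg_right (le_max_right _ _) hpp.le)
  rw [div_mul_eq_mul_div, le_div_iff₀ (by positivity)]
  linarith
end
end

section
/- Let w be a weight function on [0,1). If there exist harmonic functions f₁, …, f_J on the unit ball B_d of ℝ^d such that Σ_{j=1}^J M₂²(f_j, r) ≍ w(r)² for 0 ≤ r < 1, then w is equivalent to a log-convex weight function. -/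
open MeasureTheory Set Metric

noncomputable section

open Filter Topology

lemma cut_cont {d : ℕ} {c g : EuclideanSpace ℝ (Fin d) → ℝ} {R ρ : ℝ} (hc : Continuous c)
    (hc0 : ∀ x, R ≤ ‖x‖ → c x = 0) (hR : R < ρ) (hg : ContinuousOn g (ball 0 ρ)) :
    Continuous (fun x => c x * g x) := by
  rw [continuous_iff_continuousAt]
  intro x
  by_cases hx : ‖x‖ < ρ
  · exact hc.continuousAt.mul (hg.continuousAt (isOpen_ball.mem_nhds (by simpa using hx)))
  · have : (fun x => c x * g x) =ᶠ[𝓝 x] fun _ => 0 := by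
      have h1 : {y : EuclideanSpace ℝ (Fin d) | R < ‖y‖} ∈ 𝓝 x :=
        (isOpen_lt continuous_const continuous_norm).mem_nhds (by
          show R < ‖x‖
          linarith)
      filter_upwards [h1] with y hy
      rw [hc0 y (le_of_lt hy), zero_mul]
    exact continuousAt_const.congr this.symm

lemma cut_supp {d : ℕ} {c : EuclideanSpace ℝ (Fin d) → ℝ} {R : ℝ}
    (hc0 : ∀ x, R ≤ ‖x‖ → c x = 0) : HasCompactSupport c := by
  apply HasCompactSupport.intro (isCompact_closedBall (0 : EuclideanSpace ℝ (Fin d)) R)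
  intro x hx
  apply hc0
  simp at hx
  exact hx.le

lemma cut_int {d : ℕ} {c g : EuclideanSpace ℝ (Fin d) → ℝ} {R ρ : ℝ} (hc : Continuous c)
    (hc0 : ∀ x, R ≤ ‖x‖ → c x = 0) (hR : R < ρ) (hg : ContinuousOn g (ball 0 ρ)) :
    Integrable (fun x => c x * g x) := by
  apply (cut_cont hc hc0 hR hg).integrable_of_hasCompactSupport
  apply cut_supp (R := R)
  intro x hx
  simp [hc0 x hx]

/-- weighted Green identity -/
lemma green_s3 {d : ℕ} {u v : EuclideanSpace ℝ (Fin d) → ℝ} {R ρ : ℝ} (hR0 : 0 < R) (hR : R < ρ)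
    (hu : IsHarmonicOn u (ball 0 ρ)) (hv : IsHarmonicOn v (ball 0 ρ))
    (ψ : ℝ → ℝ) (hψ : Continuous ψ) (hψ0 : ∀ s, R ^ 2 ≤ s → ψ s = 0) :
    ∫ x : EuclideanSpace ℝ (Fin d), ψ (‖x‖ ^ 2) * (v x * fderiv ℝ u x x - u x * fderiv ℝ v x x) = 0 := by
  set Ψ : ℝ → ℝ := fun s => ∫ t in (R ^ 2)..s, ψ t with hΨ
  have hΨd : ∀ s, HasDerivAt Ψ (ψ s) s := fun s =>
    intervalIntegral.integral_hasDerivAt_right (hψ.intervalIntegrable _ _)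
      (hψ.stronglyMeasurableAtFilter _ _) hψ.continuousAt
  have hΨ0 : ∀ s, R ^ 2 ≤ s → Ψ s = 0 := by
    intro s hs
    simp only [hΨ]
    rw [intervalIntegral.integral_congr (g := fun _ => 0)]
    · simp
    · intro t ht
      rw [uIcc_of_le hs] at ht
      exact hψ0 t ht.1
  set c : EuclideanSpace ℝ (Fin d) → ℝ := fun x => Ψ (‖x‖ ^ 2) with hcdef
  have hcd : ∀ x, HasFDerivAt c (ψ (‖x‖ ^ 2) • (2 • innerSL ℝ x)) x := by
    intro x
    have h1 := (hasStrictFDerivAt_norm_sq x).hasFDerivAt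
    exact (hΨd (‖x‖ ^ 2)).comp_hasFDerivAt x h1
  have hcc : Continuous c := continuous_iff_continuousAt.2 fun x => (hcd x).continuousAt
  have hsq : ∀ x : EuclideanSpace ℝ (Fin d), R ≤ ‖x‖ → R ^ 2 ≤ ‖x‖ ^ 2 := fun x hx => by
    gcongr
  have hc0 : ∀ x, R ≤ ‖x‖ → c x = 0 := fun x hx => hΨ0 _ (hsq x hx)
  have hψc : Continuous fun x : EuclideanSpace ℝ (Fin d) => ψ (‖x‖ ^ 2) := by fun_prop
  have hψc0 : ∀ x : EuclideanSpace ℝ (Fin d), R ≤ ‖x‖ → ψ (‖x‖ ^ 2) = 0 :=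
    fun x hx => hψ0 _ (hsq x hx)
  -- regularity of partial derivatives
  have hD : ∀ {u : EuclideanSpace ℝ (Fin d) → ℝ}, ContDiffOn ℝ 2 u (ball 0 ρ) → ∀ i : Fin d,
      ContDiffOn ℝ 1 (fun y => fderiv ℝ u y (EuclideanSpace.single i 1)) (ball 0 ρ) := by
    intro u hu i
    exact (hu.fderiv_of_isOpen isOpen_ball (by norm_num)).clm_apply contDiffOn_const
  set g : Fin d → EuclideanSpace ℝ (Fin d) → ℝ := fun i x =>
    v x * fderiv ℝ u x (EuclideanSpace.single i 1) - u x * fderiv ℝ v x (EuclideanSpace.single i 1)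
    with hg
  have hgC : ∀ i, ContDiffOn ℝ 1 (g i) (ball 0 ρ) := fun i =>
    ((hv.1.of_le (by norm_num)).mul (hD hu.1 i)).sub ((hu.1.of_le (by norm_num)).mul (hD hv.1 i))
  have hgcont : ∀ i, ContinuousOn (g i) (ball 0 ρ) := fun i => (hgC i).continuousOn
  have hgd : ∀ i, ContinuousOn (fun x => fderiv ℝ (g i) x (EuclideanSpace.single i 1)) (ball 0 ρ) :=
    fun i => ((hgC i).continuousOn_fderiv_of_isOpen isOpen_ball (by norm_num)).clm_apply
      continuousOn_const
  have hgdiff : ∀ i, ∀ x ∈ ball (0 : EuclideanSpace ℝ (Fin d)) ρ, DifferentiableAt ℝ (g i) x :=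
    fun i x hx => ((hgC i).differentiableOn (by norm_num)).differentiableAt (isOpen_ball.mem_nhds hx)
  have hcf : ∀ i x, fderiv ℝ c x (EuclideanSpace.single i 1) = ψ (‖x‖ ^ 2) * (2 * x i) := by
    intro i x
    rw [(hcd x).fderiv]
    simp [EuclideanSpace.inner_single_right]
  have hI1 : ∀ i, Integrable (fun x => ψ (‖x‖ ^ 2) * (2 * x i * g i x)) := fun i =>
    cut_int hψc hψc0 hR ((Continuous.continuousOn (by fun_prop)).mul (hgcont i))
  have hI2 : ∀ i, Integrable (fun x => c x * fderiv ℝ (g i) x (EuclideanSpace.single i 1)) := fun i =>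
    cut_int hcc hc0 hR (hgd i)
  have hsupp : tsupport c ⊆ ball 0 ρ := by
    refine (closure_minimal (t := closedBall 0 R) ?_ isClosed_closedBall).trans
      (closedBall_subset_ball hR)
    intro x hx
    by_contra hx'
    simp at hx'
    exact hx (hc0 x hx'.le)
  have key : ∀ i, ∫ x, c x * fderiv ℝ (g i) x (EuclideanSpace.single i 1)
      = - ∫ x, ψ (‖x‖ ^ 2) * (2 * x i * g i x) := by
    intro i
    have := integral_mul_fderiv_eq_neg_fderiv_mul_of_integrable (μ := volume) (f := c) (g := g i)
      (v := EuclideanSpace.single i 1)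
      (by simpa only [hcf, mul_assoc] using hI1 i) (hI2 i)
      (cut_int hcc hc0 hR (hgcont i)) (fun x _ => (hcd x).differentiableAt)
      (fun x hx => hgdiff i x (hsupp hx))
    rw [this]
    simp only [hcf, mul_assoc]
  have hsum := Finset.sum_congr (rfl : (Finset.univ : Finset (Fin d)) = Finset.univ)
    (fun i _ => key i)
  rw [Finset.sum_neg_distrib, ← integral_finsetSum _ (fun i _ => hI1 i),
    ← integral_finsetSum _ (fun i _ => hI2 i)] at hsum
  have hL : ∀ x, ∑ i, c x * fderiv ℝ (g i) x (EuclideanSpace.single i 1) = 0 := by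
    intro x
    by_cases hx : ‖x‖ < ρ
    · have hxb : x ∈ ball (0 : EuclideanSpace ℝ (Fin d)) ρ := by simpa using hx
      have hux : DifferentiableAt ℝ u x :=
        (hu.1.differentiableOn (by norm_num)).differentiableAt (isOpen_ball.mem_nhds hxb)
      have hvx : DifferentiableAt ℝ v x :=
        (hv.1.differentiableOn (by norm_num)).differentiableAt (isOpen_ball.mem_nhds hxb)
      have e : ∀ i, fderiv ℝ (g i) x (EuclideanSpace.single i 1) =
          v x * fderiv ℝ (fun y => fderiv ℝ u y (EuclideanSpace.single i 1)) x
            (EuclideanSpace.single i 1)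
          - u x * fderiv ℝ (fun y => fderiv ℝ v y (EuclideanSpace.single i 1)) x
            (EuclideanSpace.single i 1) := by
        intro i
        have a1 := ((hD hu.1 i).differentiableOn (by norm_num)).differentiableAt
          (isOpen_ball.mem_nhds hxb)
        have a2 := ((hD hv.1 i).differentiableOn (by norm_num)).differentiableAt
          (isOpen_ball.mem_nhds hxb)
        have := ((hvx.hasFDerivAt.mul a1.hasFDerivAt).sub (hux.hasFDerivAt.mul a2.hasFDerivAt))
        have h2 : fderiv ℝ (g i) x = _ := this.fderiv
        rw [h2]
        simp
        ring
      simp only [e]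
      rw [← Finset.mul_sum, Finset.sum_sub_distrib, ← Finset.mul_sum, ← Finset.mul_sum,
        hu.2 x hxb, hv.2 x hxb]
      simp
    · simp [hc0 x (by linarith)]
  simp only [hL, integral_zero] at hsum
  have hRR : ∀ x, ∑ i, ψ (‖x‖ ^ 2) * (2 * x i * g i x)
      = 2 * (ψ (‖x‖ ^ 2) * (v x * fderiv ℝ u x x - u x * fderiv ℝ v x x)) := by
    intro x
    have hx : ∀ (L : EuclideanSpace ℝ (Fin d) →L[ℝ] ℝ),
        L x = ∑ i, x i * L (EuclideanSpace.single i 1) := by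
      intro L
      conv_lhs => rw [← (EuclideanSpace.basisFun (Fin d) ℝ).sum_repr x]
      simp
    rw [hx (fderiv ℝ u x), hx (fderiv ℝ v x), Finset.mul_sum, Finset.mul_sum,
      ← Finset.sum_sub_distrib, Finset.mul_sum, Finset.mul_sum]
    refine Finset.sum_congr rfl fun i _ => ?_
    simp only [hg]
    ring
  simp only [hRR] at hsum
  rw [integral_const_mul] at hsum
  linarith

lemma harm_scale {d : ℕ} {f : EuclideanSpace ℝ (Fin d) → ℝ} (hf : IsHarmonicOn f (unitBall d))
    {c ρ : ℝ} (hc : 0 < c) (hρ : c * ρ ≤ 1) : IsHarmonicOn (fun x => f (c • x)) (ball 0 ρ) := by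
  have hmem : ∀ x ∈ ball (0 : EuclideanSpace ℝ (Fin d)) ρ, c • x ∈ unitBall d := by
    intro x hx
    simp only [unitBall, mem_ball_zero_iff, norm_smul, Real.norm_eq_abs, abs_of_pos hc] at hx ⊢
    nlinarith
  refine ⟨hf.1.comp (by fun_prop) hmem, fun x hx => ?_⟩
  have h := hf.2 (c • x) (hmem x hx)
  have e : ∀ i : Fin d, fderiv ℝ (fun y => fderiv ℝ (fun x => f (c • x)) y
      (EuclideanSpace.single i 1)) x (EuclideanSpace.single i 1) = c ^ 2 *
      fderiv ℝ (fun y => fderiv ℝ f y (EuclideanSpace.single i 1)) (c • x)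
      (EuclideanSpace.single i 1) := by
    intro i
    have e1 : (fun y => fderiv ℝ (fun x => f (c • x)) y (EuclideanSpace.single i 1))
        = c • (fun y => (fun z => fderiv ℝ f z (EuclideanSpace.single i 1)) (c • y)) := by
      funext y
      rw [fderiv_comp_smul]
      simp
    have e2 := fderiv_comp_smul (f := fun z => fderiv ℝ f z (EuclideanSpace.single i 1)) (x := x) c
    rw [e1, fderiv_const_smul_field, Pi.smul_apply, e2]
    simp
    ring
  simp only [e]
  rw [← Finset.mul_sum, h, mul_zero]

lemma sphere_prob {d : ℕ} (hd : 2 ≤ d) : IsProbabilityMeasure (sphereMeasure d) := by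
  have : Nonempty (Fin d) := ⟨⟨0, by omega⟩⟩
  constructor
  simp only [sphereMeasure, Measure.smul_apply, smul_eq_mul]
  apply ENNReal.inv_mul_cancel
  · rw [Ne, Measure.measure_univ_eq_zero]
    exact Measure.toSphere_ne_zero _
  · exact measure_ne_top _ _

lemma polar_avg {d : ℕ} (hd : 2 ≤ d) {P : EuclideanSpace ℝ (Fin d) → ℝ} (hP : Integrable P) :
    ∫ x, P x = ∫ x : EuclideanSpace ℝ (Fin d), ∫ y : sphere (0 : EuclideanSpace ℝ (Fin d)) 1,
      P (‖x‖ • (y : EuclideanSpace ℝ (Fin d))) ∂(sphereMeasure d) := by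
  have : Nonempty (Fin d) := ⟨⟨0, by omega⟩⟩
  set μ : Measure (EuclideanSpace ℝ (Fin d)) := volume with hμ
  set ν := Measure.volumeIoiPow (Module.finrank ℝ (EuclideanSpace ℝ (Fin d)) - 1) with hν
  have hmp := μ.measurePreserving_homeomorphUnitSphereProd
  have emb := (homeomorphUnitSphereProd (EuclideanSpace ℝ (Fin d))).measurableEmbedding
  have e : ∀ x : ({0}ᶜ : Set (EuclideanSpace ℝ (Fin d))),
      ((homeomorphUnitSphereProd _ x).2 : ℝ) • ((homeomorphUnitSphereProd _ x).1 :
        EuclideanSpace ℝ (Fin d)) = x := by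
    intro x
    have hx : ‖(x : EuclideanSpace ℝ (Fin d))‖ ≠ 0 := norm_ne_zero_iff.2 x.2
    simp [smul_smul, hx]
  have h1 : ∫ x, P x = ∫ p, P ((p.2 : ℝ) • (p.1 : EuclideanSpace ℝ (Fin d))) ∂(μ.toSphere.prod ν) := by
    rw [← hmp.integral_comp emb]
    simp only [e]
    rw [integral_subtype_comap (measurableSet_singleton _).compl P, restrict_compl_singleton]
  have h1i : Integrable (fun p : sphere (0 : EuclideanSpace ℝ (Fin d)) 1 × Ioi (0:ℝ) =>
      P ((p.2 : ℝ) • (p.1 : EuclideanSpace ℝ (Fin d)))) (μ.toSphere.prod ν) := by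
    rw [← hmp.integrable_comp_emb emb]
    simp only [Function.comp_def, e]
    have := hP.integrableOn (s := {0}ᶜ)
    rwa [integrableOn_iff_comap_subtypeVal (measurableSet_singleton _).compl] at this
  set m := μ.toSphere.real univ with hm
  have hm0 : m ≠ 0 := by
    rw [hm, measureReal_def, ENNReal.toReal_ne_zero]
    refine ⟨?_, measure_ne_top _ _⟩
    rw [Ne, Measure.measure_univ_eq_zero]
    exact Measure.toSphere_ne_zero _
  have h2 : ∀ r : ℝ, ∫ y : sphere (0 : EuclideanSpace ℝ (Fin d)) 1,
      P (r • (y : EuclideanSpace ℝ (Fin d))) ∂(sphereMeasure d) =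
      m⁻¹ * ∫ y : sphere (0 : EuclideanSpace ℝ (Fin d)) 1,
      P (r • (y : EuclideanSpace ℝ (Fin d))) ∂μ.toSphere := by
    intro r
    rw [sphereMeasure, integral_smul_measure, ENNReal.toReal_inv]
    rfl
  set Q : ℝ → ℝ := fun r => ∫ y : sphere (0 : EuclideanSpace ℝ (Fin d)) 1,
      P (r • (y : EuclideanSpace ℝ (Fin d))) ∂(sphereMeasure d) with hQ
  have h3 : ∫ x : EuclideanSpace ℝ (Fin d), Q ‖x‖ = m • ∫ r : Ioi (0:ℝ), Q r ∂ν := by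
    calc
    ∫ x : EuclideanSpace ℝ (Fin d), Q ‖x‖
      = ∫ x : ({(0)}ᶜ : Set (EuclideanSpace ℝ (Fin d))), Q (‖x.1‖) ∂(μ.comap (↑)) := by
      rw [integral_subtype_comap (measurableSet_singleton _).compl fun x ↦ Q (‖x‖),
        restrict_compl_singleton]
    _ = ∫ x, Q x.2 ∂μ.toSphere.prod ν := by
      simpa [hν] using hmp.integral_comp emb (Q ∘ Subtype.val ∘ Prod.snd)
    _ = _ := integral_fun_snd (Q ∘ Subtype.val)
  rw [h3, h1, integral_prod_symm _ h1i]
  simp only [hQ, h2]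
  rw [integral_const_mul, smul_eq_mul, ← mul_assoc, mul_inv_cancel₀ hm0, one_mul]

lemma avg_cont {d : ℕ} (hd : 2 ≤ d) {G : ℝ → sphere (0 : EuclideanSpace ℝ (Fin d)) 1 → ℝ}
    (hG : Continuous (fun p : ℝ × sphere (0 : EuclideanSpace ℝ (Fin d)) 1 => G p.1 p.2)) :
    Continuous (fun s : ℝ => ∫ y : sphere (0 : EuclideanSpace ℝ (Fin d)) 1,
      G s y ∂(sphereMeasure d)) := by
  have := sphere_prob hd
  have := continuous_parametric_integral_of_continuous (μ := sphereMeasure d)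
    (f := G) hG (isCompact_univ (X := sphere (0 : EuclideanSpace ℝ (Fin d)) 1))
  simpa using this

lemma theta_inv {d : ℕ} {f : EuclideanSpace ℝ (Fin d) → ℝ} (hf : IsHarmonicOn f (unitBall d))
    {T R : ℝ} (hR0 : 0 < R) (hRT : Real.exp T * R ≤ 1) (hT : 0 < T)
    (ψ : ℝ → ℝ) (hψ : Continuous ψ) (hψ0 : ∀ s, R ^ 2 ≤ s → ψ s = 0) {θ₀ : ℝ} (hθ₀ : |θ₀| < T) :
    ∫ x : EuclideanSpace ℝ (Fin d), ψ (‖x‖ ^ 2) * (f (Real.exp θ₀ • x) * f (Real.exp (-θ₀) • x))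
     = ∫ x : EuclideanSpace ℝ (Fin d), ψ (‖x‖ ^ 2) * (f x * f x) := by
  have hsq : ∀ x : EuclideanSpace ℝ (Fin d), R ≤ ‖x‖ → R ^ 2 ≤ ‖x‖ ^ 2 := fun x hx => by
    gcongr
  have hψc : Continuous fun x : EuclideanSpace ℝ (Fin d) => ψ (‖x‖ ^ 2) := by fun_prop
  have hψc0 : ∀ x : EuclideanSpace ℝ (Fin d), R ≤ ‖x‖ → ψ (‖x‖ ^ 2) = 0 :=
    fun x hx => hψ0 _ (hsq x hx)
  have hfc : ContinuousOn f (unitBall d) := hf.1.continuousOn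
  have hDc : ContinuousOn (fun x => fderiv ℝ f x x) (unitBall d) :=
    (hf.1.continuousOn_fderiv_of_isOpen isOpen_ball (by norm_num)).clm_apply continuousOn_id
  have hfd : ∀ x ∈ unitBall d, DifferentiableAt ℝ f x := fun x hx =>
    (hf.1.differentiableOn (by norm_num)).differentiableAt (isOpen_ball.mem_nhds hx)
  set A : ℝ → ℝ := fun θ => ∫ x : EuclideanSpace ℝ (Fin d),
    ψ (‖x‖ ^ 2) * (f (Real.exp θ • x) * f (Real.exp (-θ) • x)) with hA
  have hder : ∀ θ ∈ Ioo (-T) T, HasDerivAt A 0 θ := by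
    intro θ hθ
    obtain ⟨T', hT1, hT2⟩ := exists_between (abs_lt.2 hθ)
    have hT'0 : 0 < T' := (abs_nonneg θ).trans_lt hT1
    set q := Real.exp T' * R with hq
    have hq0 : 0 < q := by positivity
    have hq1 : q < 1 := by
      refine lt_of_lt_of_le ?_ hRT
      have := Real.exp_lt_exp.2 hT2
      rw [hq]
      gcongr
    obtain ⟨K₁, hK₁⟩ := (isCompact_closedBall (0 : EuclideanSpace ℝ (Fin d)) q).exists_bound_of_continuousOn
      (hfc.mono (closedBall_subset_ball hq1))
    obtain ⟨K₂, hK₂⟩ := (isCompact_closedBall (0 : EuclideanSpace ℝ (Fin d)) q).exists_bound_of_continuousOn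
      (hDc.mono (closedBall_subset_ball hq1))
    have hsc : ∀ τ ∈ Ioo (-T') T', ∀ x : EuclideanSpace ℝ (Fin d), ‖x‖ < R →
        Real.exp τ • x ∈ closedBall (0 : EuclideanSpace ℝ (Fin d)) q := by
      intro τ hτ x hx
      rw [mem_closedBall_zero_iff, norm_smul, Real.norm_eq_abs, abs_of_pos (Real.exp_pos _), hq]
      have := Real.exp_le_exp.2 hτ.2.le
      gcongr
    have hneg : ∀ τ ∈ Ioo (-T') T', -τ ∈ Ioo (-T') T' := fun τ hτ =>
      ⟨by linarith [hτ.2], by linarith [hτ.1]⟩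
    have hball : closedBall (0 : EuclideanSpace ℝ (Fin d)) q ⊆ unitBall d :=
      closedBall_subset_ball hq1
    -- continuity of scaled functions on a slightly larger ball
    set ρ := Real.exp (-T') with hρ
    have hRρ : R < ρ := by
      rw [hρ, Real.exp_neg, lt_inv_comm₀ hR0 (Real.exp_pos _)]
      rw [hq] at hq1
      rwa [lt_inv_comm₀ (Real.exp_pos _) hR0, ← one_div, lt_div_iff₀' (Real.exp_pos _)]
    have hle : ∀ τ ∈ Ioo (-T') T', Real.exp τ * ρ ≤ 1 := by
      intro τ hτ
      rw [hρ, ← Real.exp_add, Real.exp_le_one_iff]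
      linarith [hτ.2]
    have hscb : ∀ τ ∈ Ioo (-T') T', ∀ x ∈ ball (0 : EuclideanSpace ℝ (Fin d)) ρ,
        Real.exp τ • x ∈ unitBall d := by
      intro τ hτ x hx
      rw [mem_ball_zero_iff] at hx
      rw [unitBall, mem_ball_zero_iff, norm_smul, Real.norm_eq_abs, abs_of_pos (Real.exp_pos _)]
      have := hle τ hτ
      have h3 := Real.exp_pos τ
      nlinarith
    have hc1 : ∀ τ ∈ Ioo (-T') T', ContinuousOn (fun x => f (Real.exp τ • x)) (ball 0 ρ) :=
      fun τ hτ => hfc.comp (by fun_prop) (hscb τ hτ)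
    have hc2 : ∀ τ ∈ Ioo (-T') T', ContinuousOn
        (fun x => fderiv ℝ f (Real.exp τ • x) (Real.exp τ • x)) (ball 0 ρ) :=
      fun τ hτ => hDc.comp (by fun_prop) (hscb τ hτ)
    have hθ' : θ ∈ Ioo (-T') T' := abs_lt.1 hT1
    have hdf : ∀ τ ∈ Ioo (-T') T', ∀ x : EuclideanSpace ℝ (Fin d), ‖x‖ < R →
        HasDerivAt (fun τ => f (Real.exp τ • x))
          (fderiv ℝ f (Real.exp τ • x) (Real.exp τ • x)) τ := by
      intro τ hτ x hx
      exact (hfd _ (hball (hsc τ hτ x hx))).hasFDerivAt.comp_hasDerivAt τ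
        ((Real.hasDerivAt_exp τ).smul_const x)
    set F' : ℝ → EuclideanSpace ℝ (Fin d) → ℝ := fun τ x => ψ (‖x‖ ^ 2) *
      (fderiv ℝ f (Real.exp τ • x) (Real.exp τ • x) * f (Real.exp (-τ) • x)
        - f (Real.exp τ • x) * fderiv ℝ f (Real.exp (-τ) • x) (Real.exp (-τ) • x)) with hF'
    have hmain := hasDerivAt_integral_of_dominated_loc_of_deriv_le (μ := volume)
      (F := fun τ (x : EuclideanSpace ℝ (Fin d)) =>
        ψ (‖x‖ ^ 2) * (f (Real.exp τ • x) * f (Real.exp (-τ) • x))) (F' := F') (x₀ := θ)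
      (s := Ioo (-T') T') (bound := fun x => ‖ψ (‖x‖ ^ 2)‖ * (K₂ * K₁ + K₁ * K₂))
      (isOpen_Ioo.mem_nhds hθ')
      (by
        filter_upwards [isOpen_Ioo.mem_nhds hθ'] with τ hτ
        exact (cut_cont hψc hψc0 hRρ ((hc1 τ hτ).mul (hc1 _ (hneg τ hτ)))).aestronglyMeasurable)
      (cut_int hψc hψc0 hRρ ((hc1 θ hθ').mul (hc1 _ (hneg θ hθ'))))
      (cut_cont hψc hψc0 hRρ (((hc2 θ hθ').mul (hc1 _ (hneg θ hθ'))).sub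
        ((hc1 θ hθ').mul (hc2 _ (hneg θ hθ'))))).aestronglyMeasurable
      (by
        refine Eventually.of_forall fun x τ hτ => ?_
        by_cases hx : ‖x‖ < R
        · simp only [hF']
          rw [norm_mul]
          have b1 := hK₁ _ (hsc τ hτ x hx)
          have b2 := hK₁ _ (hsc _ (hneg τ hτ) x hx)
          have b3 := hK₂ _ (hsc τ hτ x hx)
          have b4 := hK₂ _ (hsc _ (hneg τ hτ) x hx)
          have k1 : 0 ≤ K₁ := (norm_nonneg _).trans b1
          have k2 : 0 ≤ K₂ := (norm_nonneg _).trans b3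
          gcongr
          refine (norm_sub_le _ _).trans ?_
          rw [norm_mul, norm_mul]
          gcongr
        · simp [hF', hψc0 x (not_lt.1 hx)])
      (cut_int (R := R) (ρ := R + 1) hψc.norm (fun x hx => by simp [hψc0 x hx]) (by linarith)
        continuousOn_const)
      (by
        refine Eventually.of_forall fun x τ hτ => ?_
        by_cases hx : ‖x‖ < R
        · have h1 := hdf τ hτ x hx
          have h2 : HasDerivAt (fun τ => f (Real.exp (-τ) • x)) _ τ :=
            (hdf (-τ) (hneg τ hτ) x hx).scomp τ (hasDerivAt_neg τ)
          have h3 := (h1.mul h2).const_mul (ψ (‖x‖ ^ 2))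
          convert! h3 using 1
          simp only [hF', smul_eq_mul]
          ring
        · simp only [hF', hψc0 x (not_lt.1 hx), zero_mul]
          exact hasDerivAt_const _ _)
    have hz : ∫ x, F' θ x = 0 := by
      have hg := green_s3 hR0 hRρ (harm_scale hf (Real.exp_pos θ) (hle θ hθ'))
        (harm_scale hf (Real.exp_pos (-θ)) (hle _ (hneg θ hθ'))) ψ hψ hψ0
      rw [← hg]
      congr 1
      funext x
      simp only [hF']
      rw [fderiv_comp_smul, fderiv_comp_smul]
      simp
      left
      ring
    rw [← hz]
    exact hmain.2
  have hconst : A θ₀ = A 0 := by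
    apply isOpen_Ioo.is_const_of_deriv_eq_zero (s := Ioo (-T) T) isPreconnected_Ioo
      (fun θ hθ => (hder θ hθ).differentiableAt.differentiableWithinAt)
      (fun θ hθ => (hder θ hθ).deriv) (abs_lt.1 hθ₀) ⟨by linarith, hT⟩
  simpa [hA] using hconst

lemma sph_norm {d : ℕ} (y : sphere (0 : EuclideanSpace ℝ (Fin d)) 1) {r : ℝ} (hr : 0 ≤ r) :
    ‖r • (y : EuclideanSpace ℝ (Fin d))‖ = r := by
  rw [norm_smul, norm_eq_of_mem_sphere, mul_one, Real.norm_eq_abs, abs_of_nonneg hr]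

lemma sph_cont {d : ℕ} {f : EuclideanSpace ℝ (Fin d) → ℝ} (hf : ContinuousOn f (unitBall d))
    {r : ℝ} (hr : 0 ≤ r) (hr1 : r < 1) :
    Continuous (fun y : sphere (0 : EuclideanSpace ℝ (Fin d)) 1 =>
      f (r • (y : EuclideanSpace ℝ (Fin d)))) := by
  apply hf.comp_continuous (by fun_prop)
  intro y
  rw [unitBall, mem_ball_zero_iff, sph_norm y hr]
  exact hr1

lemma sph_int {d : ℕ} (hd : 2 ≤ d) {g : sphere (0 : EuclideanSpace ℝ (Fin d)) 1 → ℝ}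
    (hg : Continuous g) : Integrable g (sphereMeasure d) := by
  have := sphere_prob hd
  exact hg.integrable_of_hasCompactSupport (HasCompactSupport.of_compactSpace g)

lemma M2sq_cont {d : ℕ} (hd : 2 ≤ d) {f : EuclideanSpace ℝ (Fin d) → ℝ}
    (hf : ContinuousOn f (unitBall d)) : ContinuousOn (M2sq f) (Ico 0 1) := by
  intro r₀ hr₀
  obtain ⟨q, hq1, hq2⟩ := exists_between hr₀.2
  have hq0 : 0 < q := hr₀.1.trans_lt hq1
  have hc : Continuous (fun r : ℝ => ∫ y : sphere (0 : EuclideanSpace ℝ (Fin d)) 1,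
      (f ((max 0 (min r q)) • (y : EuclideanSpace ℝ (Fin d)))) ^ 2 ∂(sphereMeasure d)) := by
    apply avg_cont hd (G := fun r y => (f ((max 0 (min r q)) • (y : EuclideanSpace ℝ (Fin d)))) ^ 2)
    apply Continuous.pow
    apply hf.comp_continuous (by fun_prop)
    intro p
    rw [unitBall, mem_ball_zero_iff, sph_norm _ (le_max_left _ _)]
    exact max_lt (by norm_num) ((min_le_right _ _).trans_lt hq2)
  refine hc.continuousWithinAt.congr_of_eventuallyEq ?_ ?_
  · filter_upwards [self_mem_nhdsWithin, mem_nhdsWithin_of_mem_nhds (Iio_mem_nhds hq1)] with r hr hr'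
    rw [min_eq_left (le_of_lt hr'), max_eq_right hr.1, M2sq]
  · rw [min_eq_left hq1.le, max_eq_right hr₀.1, M2sq]

lemma prod_inv {d : ℕ} (hd : 2 ≤ d) {f : EuclideanSpace ℝ (Fin d) → ℝ}
    (hf : IsHarmonicOn f (unitBall d)) {a b : ℝ} (ha : a < 0) (hb : b < 0) :
    ∫ y : sphere (0 : EuclideanSpace ℝ (Fin d)) 1, f (Real.exp a • (y : EuclideanSpace ℝ (Fin d)))
      * f (Real.exp b • (y : EuclideanSpace ℝ (Fin d))) ∂(sphereMeasure d)
      = M2sq f (Real.exp ((a + b) / 2)) := by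
  have := sphere_prob hd
  have : Nonempty (Fin d) := ⟨⟨0, by omega⟩⟩
  set θ := (a - b) / 2 with hθ
  set ρ₀ := Real.exp ((a + b) / 2) with hρ₀
  have hρ₀0 : 0 < ρ₀ := Real.exp_pos _
  have hlt : |θ| < -((a + b) / 2) := by
    rw [abs_lt]
    constructor <;> rw [hθ] <;> linarith
  obtain ⟨T, hT1, hT2⟩ := exists_between hlt
  have hT0 : 0 < T := (abs_nonneg _).trans_lt hT1
  obtain ⟨T', hT'1, hT'2⟩ := exists_between hT1
  set R := Real.exp (-T) with hR
  have hR0 : 0 < R := Real.exp_pos _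
  have hρR : ρ₀ < R := Real.exp_lt_exp.2 (by linarith)
  have hRT : Real.exp T * R ≤ 1 := by rw [hR, ← Real.exp_add]; simp
  set ρ := Real.exp (-T') with hρ
  have hRρ : R < ρ := Real.exp_lt_exp.2 (by linarith)
  have hfc : ContinuousOn f (unitBall d) := hf.1.continuousOn
  have hscb : ∀ τ ≤ T', ∀ x ∈ ball (0 : EuclideanSpace ℝ (Fin d)) ρ,
      Real.exp τ • x ∈ unitBall d := by
    intro τ hτ x hx
    rw [mem_ball_zero_iff] at hx
    rw [unitBall, mem_ball_zero_iff, norm_smul, Real.norm_eq_abs, abs_of_pos (Real.exp_pos _)]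
    have h1 : Real.exp τ * ρ ≤ 1 := by
      rw [hρ, ← Real.exp_add, Real.exp_le_one_iff]
      linarith
    have h3 := Real.exp_pos τ
    nlinarith
  have hc1 : ∀ τ ≤ T', ContinuousOn (fun x => f (Real.exp τ • x)) (ball 0 ρ) :=
    fun τ hτ => hfc.comp (by fun_prop) (hscb τ hτ)
  have hθT := abs_lt.1 hT'1
  have hcU : ContinuousOn (fun x => f (Real.exp θ • x) * f (Real.exp (-θ) • x)) (ball 0 ρ) :=
    (hc1 θ hθT.2.le).mul (hc1 (-θ) (by linarith [hθT.1]))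
  have hcV : ContinuousOn (fun x => f x * f x) (ball 0 ρ) := by
    have := hc1 0 ((abs_nonneg _).trans hT'1.le)
    simp only [Real.exp_zero, one_smul] at this
    exact this.mul this
  set D : EuclideanSpace ℝ (Fin d) → ℝ := fun x =>
    f (Real.exp θ • x) * f (Real.exp (-θ) • x) - f x * f x with hD
  have hDc : ContinuousOn D (ball 0 ρ) := hcU.sub hcV
  set φ : ℝ → ℝ := fun s => max 0 (R ^ 2 - s) with hφ
  have hφc : Continuous φ := by fun_prop
  have hφ0 : ∀ s, R ^ 2 ≤ s → φ s = 0 := fun s hs => max_eq_left (by linarith)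
  have hsq : ∀ x : EuclideanSpace ℝ (Fin d), R ≤ ‖x‖ → R ^ 2 ≤ ‖x‖ ^ 2 := fun x hx => by
    gcongr
  set P : EuclideanSpace ℝ (Fin d) → ℝ := fun x => φ (‖x‖ ^ 2) * D x with hP
  have hP0 : ∀ x, R ≤ ‖x‖ → P x = 0 := fun x hx => by simp [hP, hφ0 _ (hsq x hx)]
  have hPc : Continuous P := cut_cont (c := fun x => φ (‖x‖ ^ 2)) (by fun_prop)
    (fun x hx => hφ0 _ (hsq x hx)) hRρ hDc
  set α : ℝ → ℝ := fun s => ∫ y : sphere (0 : EuclideanSpace ℝ (Fin d)) 1,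
    P (√s • (y : EuclideanSpace ℝ (Fin d))) ∂(sphereMeasure d) with hα
  have hαc : Continuous α := by
    apply avg_cont hd (G := fun s y => P (√s • (y : EuclideanSpace ℝ (Fin d))))
    exact hPc.comp (by fun_prop)
  have hα0 : ∀ s, R ^ 2 ≤ s → α s = 0 := by
    intro s hs
    simp only [hα]
    rw [integral_eq_zero_of_ae]
    refine Eventually.of_forall fun y => ?_
    apply hP0
    rw [sph_norm y (Real.sqrt_nonneg _)]
    exact Real.le_sqrt_of_sq_le hs
  have hψ0 : ∀ s, R ^ 2 ≤ s → φ s * α s = 0 := fun s hs => by rw [hφ0 s hs, zero_mul]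
  have h1 := theta_inv hf hR0 hRT hT0 (fun s => φ s * α s) (hφc.mul hαc) hψ0 hT1
  have h2 : ∫ x : EuclideanSpace ℝ (Fin d), α (‖x‖ ^ 2) * P x = 0 := by
    have e : (fun x : EuclideanSpace ℝ (Fin d) => α (‖x‖ ^ 2) * P x) = fun x =>
      φ (‖x‖ ^ 2) * α (‖x‖ ^ 2) * (f (Real.exp θ • x) * f (Real.exp (-θ) • x))
        - φ (‖x‖ ^ 2) * α (‖x‖ ^ 2) * (f x * f x) := by
      funext x
      simp only [hP, hD]
      ring
    have i1 := cut_int (c := fun x : EuclideanSpace ℝ (Fin d) => φ (‖x‖ ^ 2) * α (‖x‖ ^ 2))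
      (by fun_prop) (fun x hx => hψ0 _ (hsq x hx)) hRρ hcU
    have i2 := cut_int (c := fun x : EuclideanSpace ℝ (Fin d) => φ (‖x‖ ^ 2) * α (‖x‖ ^ 2))
      (by fun_prop) (fun x hx => hψ0 _ (hsq x hx)) hRρ hcV
    rw [e, integral_sub i1 i2, h1, sub_self]
  have hiP : Integrable (fun x : EuclideanSpace ℝ (Fin d) => α (‖x‖ ^ 2) * P x) :=
    cut_int (R := R) (ρ := R + 1) (c := fun x => α (‖x‖ ^ 2)) (by fun_prop)
      (fun x hx => hα0 _ (hsq x hx)) (by linarith) hPc.continuousOn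
  rw [polar_avg hd hiP] at h2
  have h3 : ∀ x : EuclideanSpace ℝ (Fin d), ∫ y : sphere (0 : EuclideanSpace ℝ (Fin d)) 1,
      α (‖‖x‖ • (y : EuclideanSpace ℝ (Fin d))‖ ^ 2) * P (‖x‖ • (y : EuclideanSpace ℝ (Fin d)))
      ∂(sphereMeasure d) = α (‖x‖ ^ 2) * α (‖x‖ ^ 2) := by
    intro x
    simp only [sph_norm _ (norm_nonneg x)]
    rw [integral_const_mul]
    congr 1
    simp only [hα, Real.sqrt_sq (norm_nonneg x)]
  simp only [h3] at h2
  have hcα : Continuous (fun x : EuclideanSpace ℝ (Fin d) => α (‖x‖ ^ 2) * α (‖x‖ ^ 2)) := by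
    fun_prop
  have hiα : Integrable (fun x : EuclideanSpace ℝ (Fin d) => α (‖x‖ ^ 2) * α (‖x‖ ^ 2)) :=
    cut_int (R := R) (ρ := R + 1) (c := fun x => α (‖x‖ ^ 2)) (by fun_prop)
      (fun x hx => hα0 _ (hsq x hx)) (by linarith) (Continuous.continuousOn (by fun_prop))
  have h4 := (integral_eq_zero_iff_of_nonneg (fun x => mul_self_nonneg _) hiα).1 h2
  have h5 := (hcα.ae_eq_iff_eq volume (continuous_const (y := (0:ℝ)))).1 h4
  obtain ⟨x₀, hx₀⟩ : ∃ x₀ : EuclideanSpace ℝ (Fin d), ‖x₀‖ = ρ₀ :=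
    ⟨EuclideanSpace.single (Classical.arbitrary _) ρ₀, by simp [abs_of_pos hρ₀0]⟩
  have h6 : α (ρ₀ ^ 2) = 0 := by
    have := congrFun h5 x₀
    simpa [hx₀] using this
  have h7 : φ (ρ₀ ^ 2) * ∫ y : sphere (0 : EuclideanSpace ℝ (Fin d)) 1,
      D (ρ₀ • (y : EuclideanSpace ℝ (Fin d))) ∂(sphereMeasure d) = 0 := by
    rw [← h6]
    simp only [hα, hP, Real.sqrt_sq hρ₀0.le, sph_norm _ hρ₀0.le]
    rw [integral_const_mul]
  have h8 : φ (ρ₀ ^ 2) ≠ 0 := by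
    have : ρ₀ ^ 2 < R ^ 2 := by gcongr
    have : 0 < φ (ρ₀ ^ 2) := lt_max_of_lt_right (by linarith)
    exact this.ne'
  have h9 := (mul_eq_zero.1 h7).resolve_left h8
  have ea : Real.exp θ * ρ₀ = Real.exp a := by
    rw [hρ₀, ← Real.exp_add]; congr 1; rw [hθ]; ring
  have eb : Real.exp (-θ) * ρ₀ = Real.exp b := by
    rw [hρ₀, ← Real.exp_add]; congr 1; rw [hθ]; ring
  simp only [hD, smul_smul, ea, eb] at h9
  have ca := sph_cont hfc (Real.exp_pos a).le (Real.exp_lt_one_iff.2 ha)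
  have cb := sph_cont hfc (Real.exp_pos b).le (Real.exp_lt_one_iff.2 hb)
  have c0 := sph_cont hfc hρ₀0.le (Real.exp_lt_one_iff.2 (show (a + b) / 2 < 0 by linarith))
  rw [integral_sub (sph_int hd (ca.fun_mul cb)) (sph_int hd (c0.fun_mul c0))] at h9
  rw [M2sq]
  simp only [pow_two]
  linarith

lemma midpoint_ineq {d : ℕ} (hd : 2 ≤ d) {f : EuclideanSpace ℝ (Fin d) → ℝ}
    (hf : IsHarmonicOn f (unitBall d)) {a b : ℝ} (ha : a < 0) (hb : b < 0) (l : ℝ) :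
    0 ≤ M2sq f (Real.exp a) - 2 * l * M2sq f (Real.exp ((a + b) / 2))
      + l ^ 2 * M2sq f (Real.exp b) := by
  have hfc : ContinuousOn f (unitBall d) := hf.1.continuousOn
  have ca := sph_cont hfc (Real.exp_pos a).le (Real.exp_lt_one_iff.2 ha)
  have cb := sph_cont hfc (Real.exp_pos b).le (Real.exp_lt_one_iff.2 hb)
  have i1 := sph_int hd (g := fun y => f (Real.exp a • (y : EuclideanSpace ℝ (Fin d))) ^ 2)
    (ca.pow 2)
  have i2 := sph_int hd (g := fun y => 2 * l * (f (Real.exp a • (y : EuclideanSpace ℝ (Fin d))) *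
    f (Real.exp b • (y : EuclideanSpace ℝ (Fin d))))) (continuous_const.mul (ca.mul cb))
  have i3 := sph_int hd (g := fun y => l ^ 2 * f (Real.exp b • (y : EuclideanSpace ℝ (Fin d))) ^ 2)
    (continuous_const.mul (cb.pow 2))
  have i4 : Integrable (fun y : sphere (0 : EuclideanSpace ℝ (Fin d)) 1 =>
    f (Real.exp a • (y : EuclideanSpace ℝ (Fin d))) ^ 2 -
    2 * l * (f (Real.exp a • (y : EuclideanSpace ℝ (Fin d))) *
    f (Real.exp b • (y : EuclideanSpace ℝ (Fin d))))) (sphereMeasure d) := i1.sub i2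
  have : 0 ≤ ∫ y : sphere (0 : EuclideanSpace ℝ (Fin d)) 1,
      (f (Real.exp a • (y : EuclideanSpace ℝ (Fin d)))
      - l * f (Real.exp b • (y : EuclideanSpace ℝ (Fin d)))) ^ 2 ∂(sphereMeasure d) :=
    integral_nonneg fun y => sq_nonneg _
  refine this.trans_eq ?_
  rw [← prod_inv hd hf ha hb, M2sq, M2sq, ← integral_const_mul, ← integral_const_mul,
    ← integral_sub i1 i2, ← integral_add i4 i3]
  congr 1
  funext y
  ring

lemma conv_mid {L : ℝ → ℝ} (hc : ContinuousOn L (Iio 0))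
    (hm : ∀ a < 0, ∀ b < 0, L ((a + b) / 2) ≤ (L a + L b) / 2) : ConvexOn ℝ (Iio 0) L := by
  refine ⟨convex_Iio 0, ?_⟩
  intro x hx y hy p q hp hq hpq
  have hx' : x < 0 := hx
  have hy' : y < 0 := hy
  have hneg : ∀ t ∈ Icc (0:ℝ) 1, (1 - t) * x + t * y < 0 := by
    intro t ht
    rcases eq_or_lt_of_le ht.1 with h | h
    · rw [← h]; linarith
    · have : 0 ≤ 1 - t := by linarith [ht.2]
      nlinarith
  set g : ℝ → ℝ := fun t => L ((1 - t) * x + t * y) - ((1 - t) * L x + t * L y) with hg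
  have hgc : ContinuousOn g (Icc 0 1) := by
    apply ContinuousOn.sub
    · exact hc.comp (by fun_prop) hneg
    · fun_prop
  have hgm : ∀ s ∈ Icc (0:ℝ) 1, ∀ t ∈ Icc (0:ℝ) 1, g ((s + t) / 2) ≤ (g s + g t) / 2 := by
    intro s hs t ht
    have := hm _ (hneg s hs) _ (hneg t ht)
    have e : (1 - (s + t) / 2) * x + (s + t) / 2 * y
      = ((1 - s) * x + s * y + ((1 - t) * x + t * y)) / 2 := by ring
    simp only [hg]
    rw [e]
    linarith
  obtain ⟨t₀, ht₀, hmax⟩ := isCompact_Icc.exists_isMaxOn (nonempty_Icc.2 zero_le_one) hgc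
  have hle : ∀ t ∈ Icc (0:ℝ) 1, g t ≤ g t₀ := fun t ht => hmax ht
  have hM : g t₀ ≤ 0 := by
    by_contra hpos
    push Not at hpos
    have hK : IsCompact (Icc (0:ℝ) 1 ∩ g ⁻¹' {g t₀}) :=
      isCompact_Icc.of_isClosed_subset (hgc.preimage_isClosed_of_isClosed isClosed_Icc
        isClosed_singleton) inter_subset_left
    obtain ⟨m, ⟨hm1, hm2⟩, hleast⟩ := hK.exists_isLeast ⟨t₀, ht₀, rfl⟩
    have hm2' : g m = g t₀ := hm2
    have g0 : g 0 = 0 := by simp [hg]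
    have g1 : g 1 = 0 := by simp [hg]
    have m0 : 0 < m := lt_of_le_of_ne hm1.1 (by
      rintro rfl
      linarith)
    have m1 : m < 1 := lt_of_le_of_ne hm1.2 (by
      rintro rfl
      linarith)
    set δ := min m (1 - m) with hδ
    have hδ0 : 0 < δ := lt_min m0 (by linarith)
    have hδ1 : δ ≤ m := min_le_left _ _
    have hδ2 : δ ≤ 1 - m := min_le_right _ _
    have i1 : m - δ ∈ Icc (0:ℝ) 1 := ⟨by linarith, by linarith⟩
    have i2 : m + δ ∈ Icc (0:ℝ) 1 := ⟨by linarith, by linarith⟩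
    have h1 := hgm _ i1 _ i2
    rw [show (m - δ + (m + δ)) / 2 = m by ring] at h1
    have h2 := hle _ i2
    have h3 : g (m - δ) < g t₀ := by
      refine lt_of_le_of_ne (hle _ i1) fun h => ?_
      have : m ≤ m - δ := hleast ⟨i1, h⟩
      linarith
    linarith
  have := (hle q ⟨hq, by linarith⟩).trans hM
  have hp' : p = 1 - q := by linarith
  simp only [hg] at this
  simp only [smul_eq_mul, hp']
  linarith

theorem stmt3 {d : ℕ} (hd : 2 ≤ d) (w : ℝ → ℝ) (hw : IsWeight w)
    (J : ℕ) (f : Fin J → (EuclideanSpace ℝ (Fin d) → ℝ))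
    (hf : ∀ j, IsHarmonicOn (f j) (unitBall d))
    (C₁ C₂ : ℝ) (hC₁ : 0 < C₁) (hC₂ : 0 < C₂)
    (h : ∀ r ∈ Set.Ico (0:ℝ) 1,
      C₁ * (w r)^2 ≤ ∑ j, M2sq (f j) r ∧ ∑ j, M2sq (f j) r ≤ C₂ * (w r)^2) :
    ∃ v : ℝ → ℝ, IsWeight v ∧ IsLogConvex v ∧ EquivOn01 w v := by
  set N : ℝ → ℝ := fun r => ∑ j, M2sq (f j) r with hN
  obtain ⟨hw1, hw2, hw3, hw4⟩ := hw
  have hNpos : ∀ r ∈ Ico (0:ℝ) 1, 0 < N r := fun r hr => by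
    have := hw3 r hr
    have h1 := (h r hr).1
    have : 0 < C₁ * (w r) ^ 2 := by positivity
    exact this.trans_le h1
  have hNc : ContinuousOn N (Ico 0 1) :=
    continuousOn_finsetSum _ fun j _ => M2sq_cont hd (hf j).1.continuousOn
  have hexp : ∀ t < 0, Real.exp t ∈ Ico (0:ℝ) 1 := fun t ht =>
    ⟨(Real.exp_pos t).le, Real.exp_lt_one_iff.2 ht⟩
  set L : ℝ → ℝ := fun t => Real.log (N (Real.exp t)) with hL
  have hLc : ContinuousOn L (Iio 0) := by
    apply ContinuousOn.log
    · exact hNc.comp (by fun_prop) (fun t ht => hexp t ht)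
    · exact fun t ht => (hNpos _ (hexp t ht)).ne'
  have hLm : ∀ a < 0, ∀ b < 0, L ((a + b) / 2) ≤ (L a + L b) / 2 := by
    intro a ha b hb
    have pa := hNpos _ (hexp a ha)
    have pb := hNpos _ (hexp b hb)
    have pm := hNpos _ (hexp ((a + b) / 2) (by linarith))
    have key : ∀ l : ℝ, 0 ≤ N (Real.exp a) - 2 * l * N (Real.exp ((a + b) / 2))
        + l ^ 2 * N (Real.exp b) := by
      intro l
      simp only [hN]
      rw [Finset.mul_sum, Finset.mul_sum, ← Finset.sum_sub_distrib, ← Finset.sum_add_distrib]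
      exact Finset.sum_nonneg fun j _ => midpoint_ineq hd (hf j) ha hb l
    have k := key (N (Real.exp ((a + b) / 2)) / N (Real.exp b))
    have hsq : N (Real.exp ((a + b) / 2)) ^ 2 ≤ N (Real.exp a) * N (Real.exp b) := by
      rw [← div_le_iff₀ pb]
      have e : N (Real.exp a) - 2 * (N (Real.exp ((a + b) / 2)) / N (Real.exp b)) *
          N (Real.exp ((a + b) / 2)) + (N (Real.exp ((a + b) / 2)) / N (Real.exp b)) ^ 2 *
          N (Real.exp b) = N (Real.exp a) - N (Real.exp ((a + b) / 2)) ^ 2 / N (Real.exp b) := by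
        field_simp
        ring
      linarith
    have hlog := Real.log_le_log (by positivity) hsq
    rw [Real.log_pow, Real.log_mul pa.ne' pb.ne'] at hlog
    push_cast at hlog
    simp only [hL]
    linarith
  have hconv : ConvexOn ℝ (Iio 0) L := conv_mid hLc hLm
  have hLmono : ∀ s t : ℝ, s < t → t < 0 → L s ≤ L t := by
    intro s t hst ht
    by_contra hlt
    push Not at hlt
    have hs : s < 0 := hst.trans ht
    have hbd : ∀ u ≤ s, L u ≤ Real.log (C₂ * w (Real.exp s) ^ 2) := by
      intro u hu
      have hu0 : u < 0 := by linarith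
      apply Real.log_le_log (hNpos _ (hexp u hu0))
      refine (h _ (hexp u hu0)).2.trans ?_
      have := hw3 _ (hexp u hu0)
      have := hw2 (hexp u hu0) (hexp s hs) (Real.exp_le_exp.2 hu)
      gcongr
    set K := Real.log (C₂ * w (Real.exp s) ^ 2) with hK
    set m := (L s - L t) / (t - s) with hm
    have hm0 : 0 < m := div_pos (by linarith) (by linarith)
    have hKs := hbd s le_rfl
    set u := s - ((K - L s) / m + 1) with hu
    have hdiv : 0 ≤ (K - L s) / m := div_nonneg (by linarith) hm0.le
    have hus : u < s := by linarith
    have hsl := hconv.slope_mono_adjacent (x := u) (y := s) (z := t)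
      (show u < 0 by linarith) ht hus hst
    have hsl' : (L s - L u) / (s - u) ≤ -m := by
      refine hsl.trans_eq ?_
      rw [hm, ← neg_div]
      ring
    rw [div_le_iff₀ (by linarith)] at hsl'
    have e : m * (s - u) = (K - L s) + m := by
      rw [hu]
      field_simp
      ring
    have := hbd u hus.le
    linarith
  have hNmono' : ∀ r s : ℝ, 0 < r → r < s → s < 1 → N r ≤ N s := by
    intro r s hr hrs hs
    have h1 := hLmono (Real.log r) (Real.log s) (Real.log_lt_log hr hrs)
      (Real.log_neg (by linarith) hs)
    simp only [hL] at h1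
    rw [Real.exp_log hr, Real.exp_log (hr.trans hrs)] at h1
    exact (Real.log_le_log_iff (hNpos r ⟨hr.le, hrs.trans hs⟩)
      (hNpos s ⟨(hr.trans hrs).le, hs⟩)).1 h1
  have hNmono : MonotoneOn N (Ico 0 1) := by
    intro r hr s hs hrs
    rcases eq_or_lt_of_le hrs with rfl | hrs
    · exact le_rfl
    rcases eq_or_lt_of_le hr.1 with h0 | h0
    · subst h0
      have hc : Tendsto N (𝓝[Ioo 0 s] 0) (𝓝 (N 0)) :=
        (hNc 0 hr).mono (fun x hx => ⟨hx.1.le, hx.2.trans hs.2⟩)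
      rw [nhdsWithin_Ioo_eq_nhdsGT hrs] at hc
      refine le_of_tendsto hc ?_
      filter_upwards [Ioo_mem_nhdsGT hrs] with x hx
      exact hNmono' x s hx.1 hx.2 hs.2
    · exact hNmono' r s h0 hrs hs.2
  have hlow : ∀ r ∈ Ico (0:ℝ) 1, √C₁ * w r ≤ √(N r) := by
    intro r hr
    apply Real.le_sqrt_of_sq_le
    rw [mul_pow, Real.sq_sqrt hC₁.le]
    exact (h r hr).1
  have hup : ∀ r ∈ Ico (0:ℝ) 1, √(N r) ≤ √C₂ * w r := by
    intro r hr
    have := hw3 r hr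
    apply Real.sqrt_le_iff.2
    refine ⟨by positivity, ?_⟩
    rw [mul_pow, Real.sq_sqrt hC₂.le]
    exact (h r hr).2
  have s1 : 0 < √C₁ := Real.sqrt_pos.2 hC₁
  have s2 : 0 < √C₂ := Real.sqrt_pos.2 hC₂
  refine ⟨fun r => √(N r), ⟨hNc.sqrt, fun r hr s hs hrs => Real.sqrt_le_sqrt (hNmono hr hs hrs),
    fun r hr => Real.sqrt_pos.2 (hNpos r hr), fun M => ?_⟩, ?_, (√C₂)⁻¹, (√C₁)⁻¹, by positivity,
    by positivity, fun r hr => ⟨?_, ?_⟩⟩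
  · obtain ⟨r, hr, hMr⟩ := hw4 (M / √C₁)
    refine ⟨r, hr, ?_⟩
    rw [div_lt_iff₀ s1] at hMr
    have := hlow r hr
    linarith
  · have e : ∀ t ∈ Iio (0:ℝ), ((1 / 2 : ℝ) • L) t = Real.log (√(N (Real.exp t))) := by
      intro t ht
      rw [Real.log_sqrt (hNpos _ (hexp t ht)).le]
      simp [hL]
      ring
    exact (hconv.smul (by norm_num : (0:ℝ) ≤ 1 / 2)).congr e
  · rw [inv_mul_le_iff₀ s2]
    exact hup r hr
  · rw [← div_eq_inv_mul, le_div_iff₀ s1, mul_comm]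
    exact hlow r hr
end
end
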